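/- Let Φ be a based root system of rank 3 such that the restriction of B to span(Δ) is positive semidefinite but not positive definite (i.e., Φ is a rank 3 affine root system). Then (Φ, Φ⁺) has a unique oriented matroid root system structure: if (Φ, α ↦ −α, d) is any OMRS on (Φ, Φ⁺), then d(X) = cone(X) ∩ Φ for every subset X ⊆ Φ. -/

import Mathlib

open Set Pointwise

variable {V : Type*} [AddCommGroup V] [Module ℝ V]

/-- `cone X` is the set of all finite nonnegative linear combinations of elements of `X`. -/
def cone (X : Set V) : Set V :=
  {v | ∃ (n : ℕ) (c : Fin n → ℝ) (x : Fin n → V),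
    (∀ i, 0 ≤ c i) ∧ (∀ i, x i ∈ X) ∧ v = ∑ i, c i • x i}

/-- An oriented matroid structure on the ground set `E ⊆ V`, with involution `x ↦ -x`
and closure operator `d` (only its values on subsets of `E` are relevant). -/
structure IsOrientedMatroidOn (E : Set V) (d : Set V → Set V) : Prop where
  neg_mem : ∀ x ∈ E, -x ∈ E
  neg_ne : ∀ x ∈ E, -x ≠ x
  cx_le_ground : ∀ X, X ⊆ E → d X ⊆ E
  le_cx : ∀ X, X ⊆ E → X ⊆ d X
  cx_mono : ∀ X Y : Set V, X ⊆ Y → Y ⊆ E → d X ⊆ d Y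
  cx_idem : ∀ X, X ⊆ E → d (d X) = d X
  cx_neg : ∀ X, X ⊆ E → d (-X) = -(d X)
  exchange2 : ∀ X, X ⊆ E → ∀ x ∈ E, x ∈ d (X ∪ {-x}) → x ∈ d X
  exchange3 : ∀ X, X ⊆ E → ∀ x ∈ E, ∀ y ∈ E,
    x ∈ d (X ∪ {-y}) → x ∉ d X → y ∈ d ((X \ {y}) ∪ {-x})
  finitary : ∀ X, X ⊆ E → ∀ x ∈ d X, ∃ Y, Y ⊆ X ∧ Y.Finite ∧ x ∈ d Y

/-- The oriented matroid is reduced: `d ∅ = ∅` and `d {x} = {x}` for `x ∈ E`. -/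
def IsReducedOn (E : Set V) (d : Set V → Set V) : Prop :=
  d ∅ = ∅ ∧ ∀ x ∈ E, d {x} = {x}

/-- A tope: a maximal `d`-closed asymmetric subset of `E`. -/
def IsTope (E : Set V) (d : Set V → Set V) (R : Set V) : Prop :=
  R ⊆ E ∧ d R ⊆ R ∧ (∀ x ∈ R, -x ∉ R) ∧
    ∀ R' : Set V, R' ⊆ E → d R' ⊆ R' → (∀ x ∈ R', -x ∉ R') → R ⊆ R' → R' = R

/-- The simple reflections `s_α : v ↦ v - 2B(v,α)α` for `α ∈ Δ`. -/
def simpleReflections (B : LinearMap.BilinForm ℝ V) (Δ : Set V) : Set (V ≃ₗ[ℝ] V) :=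
  {g | ∃ α ∈ Δ, ∀ v : V, g v = v - (2 * B v α) • α}

/-- The Weyl group generated by the simple reflections. -/
def weylGroup (B : LinearMap.BilinForm ℝ V) (Δ : Set V) : Subgroup (V ≃ₗ[ℝ] V) :=
  Subgroup.closure (simpleReflections B Δ)

/-- The root system `Φ = W·Δ`. -/
def rootSystem (B : LinearMap.BilinForm ℝ V) (Δ : Set V) : Set V :=
  {v | ∃ w ∈ weylGroup B Δ, ∃ α ∈ Δ, v = w α}

/-- The positive roots `Φ⁺ = Φ ∩ cone(Δ)`. -/
def positiveRoots (B : LinearMap.BilinForm ℝ V) (Δ : Set V) : Set V :=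
  rootSystem B Δ ∩ cone Δ

/-- A based root system with simple roots `Δ` and symmetric bilinear form `B`. -/
structure IsBasedRootSystem (B : LinearMap.BilinForm ℝ V) (Δ : Set V) : Prop where
  finite : Δ.Finite
  indep : LinearIndependent ℝ ((↑) : Δ → V)
  symm : ∀ u v : V, B u v = B v u
  diag_one : ∀ α ∈ Δ, B α α = 1
  offdiag : ∀ α ∈ Δ, ∀ β ∈ Δ, α ≠ β →
    (∃ m : ℕ, 2 ≤ m ∧ B α β = -Real.cos (Real.pi / (m : ℝ))) ∨ B α β ≤ -1

/-- An oriented matroid root system (OMRS) on `(Φ, Φ⁺)`. -/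
structure IsOMRS (B : LinearMap.BilinForm ℝ V) (Δ : Set V) (d : Set V → Set V) : Prop where
  om : IsOrientedMatroidOn (rootSystem B Δ) d
  reduced : IsReducedOn (rootSystem B Δ) d
  equivariant : ∀ w ∈ weylGroup B Δ, ∀ X, X ⊆ rootSystem B Δ → d (⇑w '' X) = ⇑w '' d X
  positive_closed : d (positiveRoots B Δ) = positiveRoots B Δ
  rank_two : ∀ X, X ⊆ rootSystem B Δ →
    Module.rank ℝ ↥(Submodule.span ℝ X) ≤ 2 → d X = cone X ∩ rootSystem B Δ

/-- `A` is `c₂`-closed in `P`. -/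
def C2Closed (P A : Set V) : Prop :=
  ∀ α ∈ A, ∀ β ∈ A, ∀ γ ∈ P, γ ∈ cone {α, β} → γ ∈ A

/-- `A` is `c₂`-biclosed in `P`. -/
def C2Biclosed (P A : Set V) : Prop :=
  C2Closed P A ∧ C2Closed P (P \ A)

/-- A root system is clean if every `c₂`-biclosed set of positive roots gives a tope of
the RRS oriented matroid `(Φ, -, cone_Φ)`. -/
def IsClean (B : LinearMap.BilinForm ℝ V) (Δ : Set V) : Prop :=
  ∀ A, A ⊆ positiveRoots B Δ → C2Biclosed (positiveRoots B Δ) A →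
    IsTope (rootSystem B Δ) (fun X => cone X ∩ rootSystem B Δ)
      (A ∪ (-(positiveRoots B Δ \ A)))

/-- Arithmetic data for the Gram matrix with off-diagonal entries `a, b, c`. -/
structure NiceData (a b c : ℝ) (m0 m1 m2 K D : ℝ) (P : ℝ → ℝ → ℝ → Prop) : Prop where
  m0_nn : 0 ≤ m0
  m1_nn : 0 ≤ m1
  m2_nn : 0 ≤ m2
  m_pos : 0 < m0 + m1 + m2
  rad0 : m0 + a * m1 + b * m2 = 0
  rad1 : a * m0 + m1 + c * m2 = 0
  rad2 : b * m0 + c * m1 + m2 = 0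
  D_pos : 0 < D
  P0 : P 1 0 0
  P1 : P 0 1 0
  P2 : P 0 0 1
  r0 : ∀ x y z, P x y z → P (-x - 2 * a * y - 2 * b * z) y z
  r1 : ∀ x y z, P x y z → P x (-y - 2 * a * x - 2 * c * z) z
  r2 : ∀ x y z, P x y z → P x y (-z - 2 * b * x - 2 * c * y)
  sgn : ∀ x y z, P x y z → (0 ≤ x ∧ 0 ≤ y ∧ 0 ≤ z) ∨ (x ≤ 0 ∧ y ≤ 0 ∧ z ≤ 0)
  bdd : ∀ x y z, P x y z → ∃ k : ℝ, |x - k * m0| ≤ K ∧ |y - k * m1| ≤ K ∧ |z - k * m2| ≤ K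
  int : ∀ x y z, P x y z → (∃ n : ℤ, x = n ∨ x = D * n) ∧ (∃ n : ℤ, y = n ∨ y = D * n) ∧
    (∃ n : ℤ, z = n ∨ z = D * n)

def Nice (a b c : ℝ) : Prop := ∃ m0 m1 m2 K D P, NiceData a b c m0 m1 m2 K D P

theorem Nice.swap01 {a b c : ℝ} (h : Nice a b c) : Nice a c b := by
  obtain ⟨m0, m1, m2, K, D, P, h⟩ := h
  refine ⟨m1, m0, m2, K, D, fun x y z => P y x z, ?_⟩
  constructor
  · exact h.m1_nn
  · exact h.m0_nn
  · exact h.m2_nn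
  · linarith [h.m_pos]
  · linarith [h.rad1]
  · linarith [h.rad0]
  · linarith [h.rad2]
  · exact h.D_pos
  · exact h.P1
  · exact h.P0
  · exact h.P2
  · intro x y z hP; exact h.r1 _ _ _ hP
  · intro x y z hP; exact h.r0 _ _ _ hP
  · intro x y z hP
    have := h.r2 _ _ _ hP
    rwa [show -z - 2 * b * y - 2 * c * x = -z - 2 * c * x - 2 * b * y by ring] at this
  · intro x y z hP
    have := h.sgn _ _ _ hP
    tauto
  · intro x y z hP
    obtain ⟨k, h1, h2, h3⟩ := h.bdd _ _ _ hP
    exact ⟨k, h2, h1, h3⟩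
  · intro x y z hP
    obtain ⟨h1, h2, h3⟩ := h.int _ _ _ hP
    exact ⟨h2, h1, h3⟩

theorem Nice.swap12 {a b c : ℝ} (h : Nice a b c) : Nice b a c := by
  obtain ⟨m0, m1, m2, K, D, P, h⟩ := h
  refine ⟨m0, m2, m1, K, D, fun x y z => P x z y, ?_⟩
  constructor
  · exact h.m0_nn
  · exact h.m2_nn
  · exact h.m1_nn
  · linarith [h.m_pos]
  · linarith [h.rad0]
  · linarith [h.rad2]
  · linarith [h.rad1]
  · exact h.D_pos
  · exact h.P0
  · exact h.P2
  · exact h.P1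
  · intro x y z hP
    have := h.r0 _ _ _ hP
    rwa [show -x - 2 * a * z - 2 * b * y = -x - 2 * b * y - 2 * a * z by ring] at this
  · intro x y z hP; exact h.r2 _ _ _ hP
  · intro x y z hP; exact h.r1 _ _ _ hP
  · intro x y z hP
    have := h.sgn _ _ _ hP
    tauto
  · intro x y z hP
    obtain ⟨k, h1, h2, h3⟩ := h.bdd _ _ _ hP
    exact ⟨k, h1, h3, h2⟩
  · intro x y z hP
    obtain ⟨h1, h2, h3⟩ := h.int _ _ _ hP
    exact ⟨h1, h3, h2⟩

theorem sgn_of_int {s0 s1 s2 : ℝ} (h0 : 0 ≤ s0) (h1 : 0 ≤ s1) (h2 : 0 ≤ s2) {n0 n1 n2 : ℤ}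
    (h : (0 ≤ n0 ∧ 0 ≤ n1 ∧ 0 ≤ n2) ∨ (n0 ≤ 0 ∧ n1 ≤ 0 ∧ n2 ≤ 0)) :
    (0 ≤ s0 * n0 ∧ 0 ≤ s1 * n1 ∧ 0 ≤ s2 * n2) ∨ (s0 * n0 ≤ 0 ∧ s1 * n1 ≤ 0 ∧ s2 * n2 ≤ 0) := by
  rcases h with ⟨a, b, c⟩ | ⟨a, b, c⟩
  · left
    have a' : (0 : ℝ) ≤ n0 := by exact_mod_cast a
    have b' : (0 : ℝ) ≤ n1 := by exact_mod_cast b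
    have c' : (0 : ℝ) ≤ n2 := by exact_mod_cast c
    exact ⟨by positivity, by positivity, by positivity⟩
  · right
    have a' : (n0 : ℝ) ≤ 0 := by exact_mod_cast a
    have b' : (n1 : ℝ) ≤ 0 := by exact_mod_cast b
    have c' : (n2 : ℝ) ≤ 0 := by exact_mod_cast c
    exact ⟨mul_nonpos_of_nonneg_of_nonpos h0 a', mul_nonpos_of_nonneg_of_nonpos h1 b',
      mul_nonpos_of_nonneg_of_nonpos h2 c'⟩

theorem int_sq_one {n : ℤ} (h : n ^ 2 = 1) : n = 1 ∨ n = -1 := by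
  have : (n - 1) * (n + 1) = 0 := by linarith
  rcases mul_eq_zero.mp this with h | h
  · left; omega
  · right; omega

theorem nice_A1 : Nice (-1) 0 0 := by
  refine ⟨1, 1, 0, 1, 1, fun x y z => ∃ n0 n1 n2 : ℤ, x = n0 ∧ y = n1 ∧ z = n2 ∧
    ((n2 ^ 2 = 1 ∧ n0 = 0 ∧ n1 = 0) ∨ (n2 = 0 ∧ (n0 - n1) ^ 2 = 1)), ?_⟩
  constructor
  · norm_num
  · norm_num
  · norm_num
  · norm_num
  · norm_num
  · norm_num
  · norm_num
  · norm_num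
  · exact ⟨1, 0, 0, by norm_num⟩
  · exact ⟨0, 1, 0, by norm_num⟩
  · exact ⟨0, 0, 1, by norm_num⟩
  · rintro x y z ⟨n0, n1, n2, rfl, rfl, rfl, h⟩
    refine ⟨-n0 + 2 * n1, n1, n2, by push_cast; ring, rfl, rfl, ?_⟩
    rcases h with ⟨h, rfl, rfl⟩ | ⟨h, h'⟩
    · left; simp [h]
    · right; exact ⟨h, by linarith⟩
  · rintro x y z ⟨n0, n1, n2, rfl, rfl, rfl, h⟩
    refine ⟨n0, -n1 + 2 * n0, n2, rfl, by push_cast; ring, rfl, ?_⟩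
    rcases h with ⟨h, rfl, rfl⟩ | ⟨h, h'⟩
    · left; simp [h]
    · right; exact ⟨h, by linarith⟩
  · rintro x y z ⟨n0, n1, n2, rfl, rfl, rfl, h⟩
    refine ⟨n0, n1, -n2, rfl, rfl, by push_cast; ring, ?_⟩
    rcases h with ⟨h, rfl, rfl⟩ | ⟨h, h'⟩
    · left; simp [h]
    · right; exact ⟨by omega, by linarith⟩
  · rintro x y z ⟨n0, n1, n2, rfl, rfl, rfl, h⟩
    norm_cast
    rcases h with ⟨h, rfl, rfl⟩ | ⟨rfl, h⟩
    · simp; omega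
    · rcases int_sq_one h with h | h <;> omega
  · rintro x y z ⟨n0, n1, n2, rfl, rfl, rfl, h⟩
    refine ⟨n0, ?_⟩
    rcases h with ⟨h, rfl, rfl⟩ | ⟨rfl, h⟩
    · simp
      rcases int_sq_one h with h | h <;> simp [h]
    · simp
      rcases int_sq_one h with h | h
      · obtain rfl : n0 = n1 + 1 := by omega
        simp
      · obtain rfl : n1 = n0 + 1 := by omega
        simp
  · rintro x y z ⟨n0, n1, n2, rfl, rfl, rfl, h⟩
    exact ⟨⟨n0, by simp⟩, ⟨n1, by simp⟩, ⟨n2, by simp⟩⟩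

theorem nice_A2 : Nice (-(1/2)) (-(1/2)) (-(1/2)) := by
  have key : ∀ n0 n1 n2 : ℤ, (n0 - n1) ^ 2 + (n1 - n2) ^ 2 + (n0 - n2) ^ 2 = 2 →
      (-1 ≤ n0 - n1 ∧ n0 - n1 ≤ 1) ∧ (-1 ≤ n1 - n2 ∧ n1 - n2 ≤ 1) ∧
      (-1 ≤ n0 - n2 ∧ n0 - n2 ≤ 1) := by
    intro n0 n1 n2 h
    refine ⟨⟨?_, ?_⟩, ⟨?_, ?_⟩, ⟨?_, ?_⟩⟩ <;>
    nlinarith [sq_nonneg (n0 - n1), sq_nonneg (n1 - n2), sq_nonneg (n0 - n2)]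
  refine ⟨1, 1, 1, 1, 1, fun x y z => ∃ n0 n1 n2 : ℤ, x = n0 ∧ y = n1 ∧ z = n2 ∧
    (n0 - n1) ^ 2 + (n1 - n2) ^ 2 + (n0 - n2) ^ 2 = 2, ?_⟩
  constructor
  · norm_num
  · norm_num
  · norm_num
  · norm_num
  · norm_num
  · norm_num
  · norm_num
  · norm_num
  · exact ⟨1, 0, 0, by norm_num⟩
  · exact ⟨0, 1, 0, by norm_num⟩
  · exact ⟨0, 0, 1, by norm_num⟩
  · rintro x y z ⟨n0, n1, n2, rfl, rfl, rfl, h⟩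
    exact ⟨-n0 + n1 + n2, n1, n2, by push_cast; ring, rfl, rfl, by linarith⟩
  · rintro x y z ⟨n0, n1, n2, rfl, rfl, rfl, h⟩
    exact ⟨n0, -n1 + n0 + n2, n2, rfl, by push_cast; ring, rfl, by linarith⟩
  · rintro x y z ⟨n0, n1, n2, rfl, rfl, rfl, h⟩
    exact ⟨n0, n1, -n2 + n0 + n1, rfl, rfl, by push_cast; ring, by linarith⟩
  · rintro x y z ⟨n0, n1, n2, rfl, rfl, rfl, h⟩
    have := key _ _ _ h
    norm_cast
    omega
  · rintro x y z ⟨n0, n1, n2, rfl, rfl, rfl, h⟩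
    have := key _ _ _ h
    refine ⟨n0, ?_⟩
    simp only [mul_one, abs_le]
    norm_cast
    omega
  · rintro x y z ⟨n0, n1, n2, rfl, rfl, rfl, h⟩
    exact ⟨⟨n0, by simp⟩, ⟨n1, by simp⟩, ⟨n2, by simp⟩⟩

theorem nice_C2 : Nice (-(√2/2)) 0 (-(√2/2)) := by
  have s2 : √2 * √2 = 2 := Real.mul_self_sqrt (by norm_num)
  have s0 : 0 ≤ √2 := Real.sqrt_nonneg _
  have s3 : √2 ≤ 2 := by nlinarith
  have key1 : ∀ n0 n1 n2 : ℤ, (n0 - n1) ^ 2 + (n1 - n2) ^ 2 = 1 →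
      (-1 ≤ n0 - n1 ∧ n0 - n1 ≤ 1) ∧ (-1 ≤ n1 - n2 ∧ n1 - n2 ≤ 1) ∧
      (n0 = n1 ∨ n1 = n2) := by
    intro n0 n1 n2 h
    have a1 : -1 ≤ n0 - n1 := by nlinarith [sq_nonneg (n1 - n2)]
    have a2 : n0 - n1 ≤ 1 := by nlinarith [sq_nonneg (n1 - n2)]
    have b1 : -1 ≤ n1 - n2 := by nlinarith [sq_nonneg (n0 - n1)]
    have b2 : n1 - n2 ≤ 1 := by nlinarith [sq_nonneg (n0 - n1)]
    refine ⟨⟨a1, a2⟩, ⟨b1, b2⟩, ?_⟩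
    by_contra! hc
    have : (n0 - n1) ^ 2 = 1 := by
      rcases (by omega : n0 - n1 = 1 ∨ n0 - n1 = -1) with e | e <;> simp [e]
    have : (n1 - n2) ^ 2 = 1 := by
      rcases (by omega : n1 - n2 = 1 ∨ n1 - n2 = -1) with e | e <;> simp [e]
    omega
  have key2 : ∀ n0 n1 n2 : ℤ, (2 * n0 - n1) ^ 2 + (n1 - 2 * n2) ^ 2 = 2 →
      (-1 ≤ 2 * n0 - n1 ∧ 2 * n0 - n1 ≤ 1) ∧ (-1 ≤ n1 - 2 * n2 ∧ n1 - 2 * n2 ≤ 1) := by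
    intro n0 n1 n2 h
    refine ⟨⟨?_, ?_⟩, ⟨?_, ?_⟩⟩ <;>
    nlinarith [sq_nonneg (2 * n0 - n1), sq_nonneg (n1 - 2 * n2)]
  refine ⟨1, √2, 1, 2, √2, fun x y z => ∃ n0 n1 n2 : ℤ,
    (x = 1 * n0 ∧ y = √2 * n1 ∧ z = 1 * n2 ∧ (n0 - n1) ^ 2 + (n1 - n2) ^ 2 = 1) ∨
    (x = √2 * n0 ∧ y = 1 * n1 ∧ z = √2 * n2 ∧ (2 * n0 - n1) ^ 2 + (n1 - 2 * n2) ^ 2 = 2), ?_⟩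
  constructor
  · norm_num
  · positivity
  · norm_num
  · positivity
  · linarith
  · linarith
  · linarith
  · positivity
  · exact ⟨1, 0, 0, Or.inl (by norm_num)⟩
  · exact ⟨0, 1, 0, Or.inr (by norm_num)⟩
  · exact ⟨0, 0, 1, Or.inl (by norm_num)⟩
  · rintro x y z ⟨n0, n1, n2, ⟨rfl, rfl, rfl, h⟩ | ⟨rfl, rfl, rfl, h⟩⟩
    · exact ⟨-n0 + 2 * n1, n1, n2, Or.inl ⟨by push_cast; linear_combination (n1 : ℝ) * s2,
        rfl, rfl, by linarith⟩⟩
    · exact ⟨-n0 + n1, n1, n2, Or.inr ⟨by push_cast; ring, rfl, rfl, by linarith⟩⟩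
  · rintro x y z ⟨n0, n1, n2, ⟨rfl, rfl, rfl, h⟩ | ⟨rfl, rfl, rfl, h⟩⟩
    · exact ⟨n0, -n1 + n0 + n2, n2, Or.inl ⟨rfl, by push_cast; ring, rfl, by linarith⟩⟩
    · exact ⟨n0, -n1 + 2 * n0 + 2 * n2, n2, Or.inr ⟨rfl,
        by push_cast; linear_combination (n0 + n2 : ℝ) * s2, rfl, by linarith⟩⟩
  · rintro x y z ⟨n0, n1, n2, ⟨rfl, rfl, rfl, h⟩ | ⟨rfl, rfl, rfl, h⟩⟩
    · exact ⟨n0, n1, -n2 + 2 * n1, Or.inl ⟨rfl, rfl,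
        by push_cast; linear_combination (n1 : ℝ) * s2, by linarith⟩⟩
    · exact ⟨n0, n1, -n2 + n1, Or.inr ⟨rfl, rfl, by push_cast; ring, by linarith⟩⟩
  · rintro x y z ⟨n0, n1, n2, ⟨rfl, rfl, rfl, h⟩ | ⟨rfl, rfl, rfl, h⟩⟩
    · have := key1 _ _ _ h
      exact sgn_of_int (by norm_num) s0 (by norm_num) (by omega)
    · have := key2 _ _ _ h
      exact sgn_of_int s0 (by norm_num) s0 (by omega)
  · rintro x y z ⟨n0, n1, n2, ⟨rfl, rfl, rfl, h⟩ | ⟨rfl, rfl, rfl, h⟩⟩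
    · have := key1 _ _ _ h
      refine ⟨n1, ?_⟩
      rw [mul_comm √2]
      simp only [mul_one, one_mul, sub_self, abs_zero, abs_le]
      norm_cast
      omega
    · obtain ⟨⟨a1, a2⟩, b1, b2⟩ := key2 _ _ _ h
      have a1' : (-1 : ℝ) ≤ 2 * n0 - n1 := by exact_mod_cast a1
      have a2' : 2 * n0 - n1 ≤ (1 : ℝ) := by exact_mod_cast a2
      have b1' : (-1 : ℝ) ≤ n1 - 2 * n2 := by exact_mod_cast b1
      have b2' : n1 - 2 * n2 ≤ (1 : ℝ) := by exact_mod_cast b2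
      have e : √2 / 2 * n1 * √2 = n1 := by linear_combination (n1 / 2 : ℝ) * s2
      refine ⟨√2 / 2 * n1, ?_⟩
      rw [e]
      simp only [abs_le]
      refine ⟨⟨?_, ?_⟩, ⟨?_, ?_⟩, ⟨?_, ?_⟩⟩ <;> nlinarith
  · rintro x y z ⟨n0, n1, n2, ⟨rfl, rfl, rfl, h⟩ | ⟨rfl, rfl, rfl, h⟩⟩
    · exact ⟨⟨n0, by simp⟩, ⟨n1, by simp⟩, ⟨n2, by simp⟩⟩
    · exact ⟨⟨n0, by simp⟩, ⟨n1, by simp⟩, ⟨n2, by simp⟩⟩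

theorem nice_G2 : Nice (-(1/2)) 0 (-(√3/2)) := by
  have s2 : √3 * √3 = 3 := Real.mul_self_sqrt (by norm_num)
  have s0 : 0 ≤ √3 := Real.sqrt_nonneg _
  have s3 : √3 ≤ 2 := by nlinarith
  have key1 : ∀ u v : ℤ, u ^ 2 + 3 * v ^ 2 = 4 →
      (u = 2 ∧ v = 0) ∨ (u = -2 ∧ v = 0) ∨ ((u = 1 ∨ u = -1) ∧ (v = 1 ∨ v = -1)) := by
    intro u v h
    have a1 : -2 ≤ u := by nlinarith
    have a2 : u ≤ 2 := by nlinarith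
    have b1 : -1 ≤ v := by nlinarith
    have b2 : v ≤ 1 := by nlinarith
    interval_cases u <;> interval_cases v <;> simp_all
  refine ⟨1, 2, √3, 3, √3, fun x y z => ∃ n0 n1 n2 : ℤ,
    (x = 1 * n0 ∧ y = 1 * n1 ∧ z = √3 * n2 ∧ (2 * n0 - n1) ^ 2 + 3 * (2 * n2 - n1) ^ 2 = 4) ∨
    (x = √3 * n0 ∧ y = √3 * n1 ∧ z = 1 * n2 ∧
      (2 * n2 - 3 * n1) ^ 2 + 3 * (2 * n0 - n1) ^ 2 = 4), ?_⟩
  constructor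
  · norm_num
  · positivity
  · positivity
  · positivity
  · linarith
  · linarith
  · linarith
  · positivity
  · exact ⟨1, 0, 0, Or.inl (by norm_num)⟩
  · exact ⟨0, 1, 0, Or.inl (by norm_num)⟩
  · exact ⟨0, 0, 1, Or.inr (by norm_num)⟩
  · rintro x y z ⟨n0, n1, n2, ⟨rfl, rfl, rfl, h⟩ | ⟨rfl, rfl, rfl, h⟩⟩
    · exact ⟨-n0 + n1, n1, n2, Or.inl ⟨by push_cast; ring, rfl, rfl, by linarith⟩⟩
    · exact ⟨-n0 + n1, n1, n2, Or.inr ⟨by push_cast; ring, rfl, rfl, by linarith⟩⟩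
  · rintro x y z ⟨n0, n1, n2, ⟨rfl, rfl, rfl, h⟩ | ⟨rfl, rfl, rfl, h⟩⟩
    · exact ⟨n0, -n1 + n0 + 3 * n2, n2, Or.inl ⟨rfl,
        by push_cast; linear_combination (n2 : ℝ) * s2, rfl, by linarith⟩⟩
    · exact ⟨n0, -n1 + n0 + n2, n2, Or.inr ⟨rfl, by push_cast; ring, rfl, by linarith⟩⟩
  · rintro x y z ⟨n0, n1, n2, ⟨rfl, rfl, rfl, h⟩ | ⟨rfl, rfl, rfl, h⟩⟩
    · exact ⟨n0, n1, -n2 + n1, Or.inl ⟨rfl, rfl, by push_cast; ring, by linarith⟩⟩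
    · exact ⟨n0, n1, -n2 + 3 * n1, Or.inr ⟨rfl, rfl,
        by push_cast; linear_combination (n1 : ℝ) * s2, by linarith⟩⟩
  · rintro x y z ⟨n0, n1, n2, ⟨rfl, rfl, rfl, h⟩ | ⟨rfl, rfl, rfl, h⟩⟩
    · have := key1 _ _ h
      exact sgn_of_int (by norm_num) (by norm_num) s0 (by omega)
    · have := key1 _ _ h
      exact sgn_of_int s0 s0 (by norm_num) (by omega)
  · rintro x y z ⟨n0, n1, n2, ⟨rfl, rfl, rfl, h⟩ | ⟨rfl, rfl, rfl, h⟩⟩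
    · have := key1 _ _ h
      have a1 : -2 ≤ 2 * n0 - n1 := by omega
      have a2 : 2 * n0 - n1 ≤ 2 := by omega
      have b1 : -1 ≤ 2 * n2 - n1 := by omega
      have b2 : 2 * n2 - n1 ≤ 1 := by omega
      have a1' : (-2 : ℝ) ≤ 2 * n0 - n1 := by exact_mod_cast a1
      have a2' : 2 * n0 - n1 ≤ (2 : ℝ) := by exact_mod_cast a2
      have b1' : (-1 : ℝ) ≤ 2 * n2 - n1 := by exact_mod_cast b1
      have b2' : 2 * n2 - n1 ≤ (1 : ℝ) := by exact_mod_cast b2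
      refine ⟨n1 / 2, ?_⟩
      simp only [abs_le]
      refine ⟨⟨?_, ?_⟩, ⟨?_, ?_⟩, ⟨?_, ?_⟩⟩ <;> nlinarith
    · have := key1 _ _ h
      have a1 : -2 ≤ 2 * n2 - 3 * n1 := by omega
      have a2 : 2 * n2 - 3 * n1 ≤ 2 := by omega
      have b1 : -1 ≤ 2 * n0 - n1 := by omega
      have b2 : 2 * n0 - n1 ≤ 1 := by omega
      have a1' : (-2 : ℝ) ≤ 2 * n2 - 3 * n1 := by exact_mod_cast a1
      have a2' : 2 * n2 - 3 * n1 ≤ (2 : ℝ) := by exact_mod_cast a2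
      have b1' : (-1 : ℝ) ≤ 2 * n0 - n1 := by exact_mod_cast b1
      have b2' : 2 * n0 - n1 ≤ (1 : ℝ) := by exact_mod_cast b2
      have e : √3 / 2 * n1 * √3 = 3 / 2 * n1 := by linear_combination (n1 / 2 : ℝ) * s2
      refine ⟨√3 / 2 * n1, ?_⟩
      rw [e]
      simp only [abs_le]
      refine ⟨⟨?_, ?_⟩, ⟨?_, ?_⟩, ⟨?_, ?_⟩⟩ <;> nlinarith
  · rintro x y z ⟨n0, n1, n2, ⟨rfl, rfl, rfl, h⟩ | ⟨rfl, rfl, rfl, h⟩⟩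
    · exact ⟨⟨n0, by simp⟩, ⟨n1, by simp⟩, ⟨n2, by simp⟩⟩
    · exact ⟨⟨n0, by simp⟩, ⟨n1, by simp⟩, ⟨n2, by simp⟩⟩

theorem solve_pqr {p q r : ℕ} (hp : 2 ≤ p) (hq : 2 ≤ q) (hr : 2 ≤ r)
    (h : q * r + p * r + p * q = p * q * r) : p ≤ 6 ∧ q ≤ 6 ∧ r ≤ 6 := by
  have aux : ∀ p q r : ℕ, 2 ≤ p → 2 ≤ q → 2 ≤ r → q * r + p * r + p * q = p * q * r → p ≤ 6 := by
    intro p q r hp hq hr h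
    by_contra! hc
    have h3 : q < 3 ∨ r < 3 := by
      by_contra! h3
      obtain ⟨h3, h4⟩ := h3
      obtain ⟨u, rfl⟩ := Nat.exists_eq_add_of_le h3
      obtain ⟨v, rfl⟩ := Nat.exists_eq_add_of_le h4
      obtain ⟨w, rfl⟩ := Nat.exists_eq_add_of_le hc
      ring_nf at h
      nlinarith [Nat.zero_le (u * v), Nat.zero_le (u * w), Nat.zero_le (v * w),
        Nat.zero_le (u * v * w)]
    obtain ⟨w, rfl⟩ := Nat.exists_eq_add_of_le hc
    rcases h3 with h3 | h3
    · obtain rfl : q = 2 := by omega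
      have h5 : 3 ≤ r := by
        by_contra! h5
        obtain rfl : r = 2 := by omega
        omega
      obtain ⟨v, rfl⟩ := Nat.exists_eq_add_of_le h5
      ring_nf at h
      nlinarith [Nat.zero_le (v * w)]
    · obtain rfl : r = 2 := by omega
      have h5 : 3 ≤ q := by
        by_contra! h5
        obtain rfl : q = 2 := by omega
        omega
      obtain ⟨v, rfl⟩ := Nat.exists_eq_add_of_le h5
      ring_nf at h
      nlinarith [Nat.zero_le (v * w)]
  exact ⟨aux p q r hp hq hr h, aux q p r hq hp hr (by linarith), aux r p q hr hp hq (by linarith)⟩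

theorem angle_sum {A B C : ℝ} (hA : 0 < A) (hB : 0 < B) (hC : 0 < C) (hA' : A ≤ Real.pi / 2)
    (hB' : B ≤ Real.pi / 2) (hC' : C ≤ Real.pi / 2)
    (h : 1 - Real.cos A ^ 2 - Real.cos B ^ 2 - Real.cos C ^ 2
      - 2 * Real.cos A * Real.cos B * Real.cos C = 0) : A + B + C = Real.pi := by
  have cA : 0 ≤ Real.cos A := Real.cos_nonneg_of_mem_Icc ⟨by linarith, hA'⟩
  have cB : 0 ≤ Real.cos B := Real.cos_nonneg_of_mem_Icc ⟨by linarith, hB'⟩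
  have cC : 0 ≤ Real.cos C := Real.cos_nonneg_of_mem_Icc ⟨by linarith, hC'⟩
  have sB : 0 ≤ Real.sin B := Real.sin_nonneg_of_nonneg_of_le_pi hB.le (by linarith)
  have sC : 0 ≤ Real.sin C := Real.sin_nonneg_of_nonneg_of_le_pi hC.le (by linarith)
  have e : (Real.cos A + Real.cos B * Real.cos C) ^ 2 = (Real.sin B * Real.sin C) ^ 2 := by
    have h1 := Real.sin_sq_add_cos_sq B
    have h2 := Real.sin_sq_add_cos_sq C
    have h3 : Real.sin B ^ 2 = 1 - Real.cos B ^ 2 := by linarith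
    have h4 : Real.sin C ^ 2 = 1 - Real.cos C ^ 2 := by linarith
    rw [mul_pow, h3, h4]
    linarith
  have e2 : Real.cos A + Real.cos B * Real.cos C = Real.sin B * Real.sin C :=
    (pow_left_inj₀ (by positivity) (by positivity) (by norm_num)).mp e
  have e3 : Real.cos A = Real.cos (Real.pi - (B + C)) := by
    rw [Real.cos_pi_sub, Real.cos_add]; linarith
  have := Real.injOn_cos ⟨hA.le, by linarith⟩ ⟨by linarith, by linarith⟩ e3
  linarith

theorem nice_of_psd {a b c : ℝ}
    (ha : (∃ m : ℕ, 2 ≤ m ∧ a = -Real.cos (Real.pi / (m : ℝ))) ∨ a ≤ -1)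
    (hb : (∃ m : ℕ, 2 ≤ m ∧ b = -Real.cos (Real.pi / (m : ℝ))) ∨ b ≤ -1)
    (hc : (∃ m : ℕ, 2 ≤ m ∧ c = -Real.cos (Real.pi / (m : ℝ))) ∨ c ≤ -1)
    (psd : ∀ x y z : ℝ, 0 ≤ x ^ 2 + y ^ 2 + z ^ 2 + 2 * a * x * y + 2 * b * x * z + 2 * c * y * z)
    (deg : ∃ x y z : ℝ, (x ≠ 0 ∨ y ≠ 0 ∨ z ≠ 0) ∧
      x ^ 2 + y ^ 2 + z ^ 2 + 2 * a * x * y + 2 * b * x * z + 2 * c * y * z = 0) :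
    Nice a b c := by
  have npos : ∀ t : ℝ, ((∃ m : ℕ, 2 ≤ m ∧ t = -Real.cos (Real.pi / (m : ℝ))) ∨ t ≤ -1) → t ≤ 0 := by
    rintro t (⟨m, hm, rfl⟩ | h)
    · have hm' : (2 : ℝ) ≤ m := by exact_mod_cast hm
      have : Real.pi / m ≤ Real.pi / 2 := by
        apply div_le_div_of_nonneg_left Real.pi_pos.le (by norm_num) hm'
      have h0 : 0 ≤ Real.pi / m := by positivity
      have := Real.cos_nonneg_of_mem_Icc (x := Real.pi / m)
        ⟨by linarith [Real.pi_pos], this⟩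
      linarith
    · linarith
  have na := npos a ha
  have nb := npos b hb
  have nc := npos c hc
  have inf : ∀ a b c : ℝ, a ≤ -1 → b ≤ 0 → c ≤ 0 →
      (∀ x y z : ℝ, 0 ≤ x ^ 2 + y ^ 2 + z ^ 2 + 2 * a * x * y + 2 * b * x * z + 2 * c * y * z) →
      a = -1 ∧ b = 0 ∧ c = 0 := by
    intro a b c ha hb hc h
    have h1 := h 1 1 0
    obtain rfl : a = -1 := by linarith
    have h2 := h 1 1 (-(b + c))
    have h3 : (b + c) ^ 2 ≤ 0 := by nlinarith
    have h4 : b + c = 0 := by nlinarith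
    exact ⟨rfl, by linarith, by linarith⟩
  rcases ha with ⟨p, hp, rfl⟩ | ha
  swap
  · obtain ⟨rfl, rfl, rfl⟩ := inf _ _ _ ha nb nc psd
    exact nice_A1
  rcases hb with ⟨q, hq, rfl⟩ | hb
  swap
  · obtain ⟨rfl, h1, rfl⟩ := inf _ _ _ hb na nc (fun x y z => by linarith [psd x z y])
    rw [h1]
    exact nice_A1.swap12
  rcases hc with ⟨r, hr, rfl⟩ | hc
  swap
  · obtain ⟨rfl, h1, h2⟩ := inf _ _ _ hc na nb (fun x y z => by linarith [psd z x y])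
    rw [h1, h2]
    exact nice_A1.swap12.swap01
  have hp' : (2 : ℝ) ≤ p := by exact_mod_cast hp
  have hq' : (2 : ℝ) ≤ q := by exact_mod_cast hq
  have hr' : (2 : ℝ) ≤ r := by exact_mod_cast hr
  have dle : ∀ m : ℝ, 2 ≤ m → Real.pi / m ≤ Real.pi / 2 := fun m hm =>
    div_le_div_of_nonneg_left Real.pi_pos.le (by norm_num) hm
  have hsum : Real.pi / p + Real.pi / q + Real.pi / r = Real.pi := by
    apply angle_sum (div_pos Real.pi_pos (by linarith)) (div_pos Real.pi_pos (by linarith))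
      (div_pos Real.pi_pos (by linarith)) (dle _ hp') (dle _ hq') (dle _ hr')
    generalize Real.cos (Real.pi / p) = u at *
    generalize Real.cos (Real.pi / q) = v at *
    generalize Real.cos (Real.pi / r) = w at *
    obtain ⟨x, y, z, hne, h0⟩ := deg
    have lin : ∀ s l : ℝ, (∀ t : ℝ, 0 ≤ t ^ 2 * s + t * l) → l = 0 := by
      intro s l h
      by_contra hl
      rcases le_or_gt s 0 with hs | hs
      · have := h (-l)
        have h2 : 0 < l ^ 2 := by positivity
        nlinarith
      · have := h (-l / (2 * s))
        have h2 : (-l / (2 * s)) ^ 2 * s + -l / (2 * s) * l = - (l ^ 2 / (4 * s)) := by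
          field_simp; ring
        rw [h2] at this
        have : 0 < l ^ 2 / (4 * s) := by positivity
        linarith
    have e1 : x - u * y - v * z = 0 := by
      apply lin (1 / 4)
      intro t
      nlinarith [psd (x + t / 2) y z]
    have e2 : y - u * x - w * z = 0 := by
      apply lin (1 / 4)
      intro t
      nlinarith [psd x (y + t / 2) z]
    have e3 : z - v * x - w * y = 0 := by
      apply lin (1 / 4)
      intro t
      nlinarith [psd x y (z + t / 2)]
    have dx : (1 - u ^ 2 - v ^ 2 - w ^ 2 - 2 * u * v * w) * x = 0 := by
      linear_combination (1 - w ^ 2) * e1 + (u + v * w) * e2 + (v + u * w) * e3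
    have dy : (1 - u ^ 2 - v ^ 2 - w ^ 2 - 2 * u * v * w) * y = 0 := by
      linear_combination (u + v * w) * e1 + (1 - v ^ 2) * e2 + (w + u * v) * e3
    have dz : (1 - u ^ 2 - v ^ 2 - w ^ 2 - 2 * u * v * w) * z = 0 := by
      linear_combination (v + u * w) * e1 + (w + u * v) * e2 + (1 - u ^ 2) * e3
    rcases hne with h | h | h
    · exact (mul_eq_zero.mp dx).resolve_right h
    · exact (mul_eq_zero.mp dy).resolve_right h
    · exact (mul_eq_zero.mp dz).resolve_right h
  have hnat : q * r + p * r + p * q = p * q * r := by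
    have pp := Real.pi_pos
    have p0 : (p : ℝ) ≠ 0 := by positivity
    have q0 : (q : ℝ) ≠ 0 := by positivity
    have r0 : (r : ℝ) ≠ 0 := by positivity
    have : (q * r + p * r + p * q : ℝ) = p * q * r := by
      field_simp at hsum
      linarith
    exact_mod_cast this
  obtain ⟨h1, h2, h3⟩ := solve_pqr hp hq hr hnat
  clear psd deg hsum na nb nc hp' hq' hr' dle inf npos
  have c2 : -Real.cos (Real.pi / 2) = 0 := by simp
  have c3 : -Real.cos (Real.pi / 3) = -(1/2) := by simp
  have c4 : -Real.cos (Real.pi / 4) = -(√2/2) := by simp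
  have c6 : -Real.cos (Real.pi / 6) = -(√3/2) := by simp
  have C2a := nice_C2
  have C2b := nice_C2.swap01
  have C2c := nice_C2.swap12
  have G1 := nice_G2
  have G2 := nice_G2.swap01
  have G3 := nice_G2.swap12
  have G4 := nice_G2.swap12.swap01
  have G5 := nice_G2.swap01.swap12
  have G6 := nice_G2.swap12.swap01.swap12
  have A2 := nice_A2
  interval_cases p <;> interval_cases q <;> first | omega | skip
  all_goals
    interval_cases r <;> first | omega | skip
  all_goals
    push_cast
    simp only [c2, c3, c4, c6]
    assumption

section OMLemmas

variable {E : Set V} {d : Set V → Set V}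

theorem om_sub (om : IsOrientedMatroidOn E d) {X Y : Set V} (hY : Y ⊆ E) (h : X ⊆ d Y) :
    d X ⊆ d Y := by
  have := om.cx_mono X (d Y) h (om.cx_le_ground Y hY)
  rwa [om.cx_idem Y hY] at this

theorem om_split (om : IsOrientedMatroidOn E d) {Z : Set V} {y g : V} (hZ : Z ⊆ E) (hy : y ∈ E)
    (hg : g ∈ E) (h : g ∈ d (insert y (insert (-y) Z))) :
    g ∈ d (insert y Z) ∨ g ∈ d (insert (-y) Z) := by
  by_contra! hc
  obtain ⟨h1, h2⟩ := hc
  have hy' := om.neg_mem y hy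
  have hg' := om.neg_mem g hg
  have hgZ : Z ∪ {-g} ⊆ E := union_subset hZ (singleton_subset_iff.mpr hg')
  have a1 : y ∈ d (Z ∪ {-g}) := by
    have := om.exchange3 (insert y Z) (insert_subset hy hZ) g hg y hy
      (by convert h using 2; ext t; simp <;> tauto) h1
    refine om.cx_mono _ _ ?_ hgZ this
    intro t; simp; tauto
  have a2 : -y ∈ d (Z ∪ {-g}) := by
    have := om.exchange3 (insert (-y) Z) (insert_subset hy' hZ) g hg (-y) hy'
      (by convert h using 2; ext t; simp <;> tauto) h2
    refine om.cx_mono _ _ ?_ hgZ this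
    intro t; simp; tauto
  have a3 : g ∈ d (Z ∪ {-g}) := by
    refine om_sub om hgZ ?_ h
    refine insert_subset a1 (insert_subset a2 ?_)
    exact subset_union_left.trans (om.le_cx _ hgZ)
  have a4 := om.exchange2 Z hZ g hg a3
  exact h1 (om.cx_mono _ _ (subset_insert _ _) (insert_subset hy hZ) a4)

theorem om_triple (om : IsOrientedMatroidOn E d) {Z : Set V} {y1 y2 y3 g : V} (hZ : Z ⊆ E)
    (h1 : y1 ∈ E) (h2 : y2 ∈ E) (h3 : y3 ∈ E) (hg : g ∈ E)
    (r1 : -y1 ∈ d {y2, y3}) (r2 : -y2 ∈ d {y1, y3}) (r3 : -y3 ∈ d {y1, y2})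
    (h : g ∈ d (insert y1 (insert y2 (insert y3 Z)))) :
    g ∈ d (insert y1 (insert y2 Z)) ∨ g ∈ d (insert y1 (insert y3 Z)) ∨
      g ∈ d (insert y2 (insert y3 Z)) := by
  have n1 := om.neg_mem _ h1
  have n2 := om.neg_mem _ h2
  have n3 := om.neg_mem _ h3
  have key : ∀ {X Y : Set V}, Y ⊆ E → X ⊆ d Y → g ∈ d X → g ∈ d Y :=
    fun hY hX hgX => om_sub om hY hX hgX
  have mem : ∀ {Y : Set V} {t : V}, Y ⊆ E → t ∈ Y → t ∈ d Y := fun hY ht => om.le_cx _ hY ht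
  have mono : ∀ {X Y : Set V} {t : V}, Y ⊆ E → X ⊆ Y → t ∈ d X → t ∈ d Y :=
    fun hY hX ht => om.cx_mono _ _ hX hY ht
  have r3' : y3 ∈ d {-y1, -y2} := by
    have := om.cx_neg {y1, y2} (by intro t; simp; rintro (rfl | rfl) <;> assumption)
    have e : -({y1, y2} : Set V) = {-y1, -y2} := by
      ext t; simp [neg_eq_iff_eq_neg]
    rw [e] at this
    rw [this]
    simpa using r3
  have sE : ∀ {p q : V}, p ∈ E → q ∈ E → insert p (insert q Z) ⊆ E :=
    fun hp hq => insert_subset hp (insert_subset hq hZ)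
  have big : insert y1 (insert (-y1) (insert y2 (insert (-y2) Z))) ⊆ E :=
    insert_subset h1 (insert_subset n1 (sE h2 n2))
  have s0 : g ∈ d (insert y1 (insert (-y1) (insert y2 (insert (-y2) Z)))) := by
    refine key big ?_ h
    refine insert_subset (mem big (by simp)) (insert_subset (mem big (by simp))
      (insert_subset ?_ ?_))
    · refine mono big ?_ r3'
      intro t; simp; tauto
    · intro t ht
      exact mem big (by simp [ht])
  have c13 : ∀ {X : Set V}, X ⊆ d (insert y1 (insert y3 Z)) → g ∈ d X →
      g ∈ d (insert y1 (insert y3 Z)) := fun hX => key (sE h1 h3) hX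
  have m2 : -y2 ∈ d (insert y1 (insert y3 Z)) := by
    refine mono (sE h1 h3) ?_ r2
    intro t; simp; tauto
  have m1 : -y1 ∈ d (insert y2 (insert y3 Z)) := by
    refine mono (sE h2 h3) ?_ r1
    intro t; simp; tauto
  rcases om_split om (sE h2 n2) h1 hg s0 with s | s
  · rw [Set.insert_comm y1, Set.insert_comm y1] at s
    rcases om_split om (insert_subset h1 hZ) h2 hg s with s | s
    · left; rwa [Set.insert_comm]
    · right; left
      refine key (sE h1 h3) ?_ s
      refine insert_subset m2 (insert_subset (mem (sE h1 h3) (by simp)) ?_)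
      intro t ht
      exact mem (sE h1 h3) (by simp [ht])
  · rw [Set.insert_comm (-y1), Set.insert_comm (-y1)] at s
    rcases om_split om (insert_subset n1 hZ) h2 hg s with s | s
    · right; right
      refine key (sE h2 h3) ?_ s
      refine insert_subset (mem (sE h2 h3) (by simp)) (insert_subset m1 ?_)
      intro t ht
      exact mem (sE h2 h3) (by simp [ht])
    · have bE : insert y1 (insert (-y1) (insert y3 Z)) ⊆ E := insert_subset h1 (sE n1 h3)
      have s' : g ∈ d (insert y1 (insert (-y1) (insert y3 Z))) := by
        refine key bE ?_ s
        refine insert_subset ?_ (insert_subset (mem bE (by simp)) ?_)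
        · refine mono bE ?_ m2
          intro t; simp; tauto
        · intro t ht
          exact mem bE (by simp [ht])
      rcases om_split om (insert_subset h3 hZ) h1 hg s' with s | s
      · right; left; exact s
      · right; right
        refine key (sE h2 h3) ?_ s
        refine insert_subset m1 ?_
        intro t ht
        exact mem (sE h2 h3) (by right; exact ht)

theorem symm_sub (om : IsOrientedMatroidOn E d) {S : Set V} (hS : S ⊆ E) : S ∪ -S ⊆ E := by
  refine union_subset hS ?_
  intro t ht
  have := om.neg_mem _ (hS ht)
  simpa using this

theorem cl_neg (om : IsOrientedMatroidOn E d) {S : Set V} (hS : S ⊆ E) {x : V}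
    (hx : x ∈ d (S ∪ -S)) : -x ∈ d (S ∪ -S) := by
  have := om.cx_neg _ (symm_sub om hS)
  have e : -(S ∪ -S) = S ∪ -S := by
    ext t; simp [or_comm]
  rw [e] at this
  rw [this]
  simpa using hx

theorem cl_sub (om : IsOrientedMatroidOn E d) {S T : Set V} (hT : T ⊆ E)
    (h : S ⊆ d (T ∪ -T)) : d (S ∪ -S) ⊆ d (T ∪ -T) := by
  refine om_sub om (symm_sub om hT) (union_subset h ?_)
  intro t ht
  have := cl_neg om hT (h ht)
  simpa using this

theorem cl_mem (om : IsOrientedMatroidOn E d) {S : Set V} (hS : S ⊆ E) {x : V}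
    (hx : x ∈ S) : x ∈ d (S ∪ -S) := om.le_cx _ (symm_sub om hS) (Or.inl hx)

theorem cl_exch (om : IsOrientedMatroidOn E d) {S : Set V} (hS : S ⊆ E) {x y : V}
    (hx : x ∈ E) (hy : y ∈ E) (h : x ∈ d (insert y S ∪ -(insert y S)))
    (h' : x ∉ d (S ∪ -S)) : y ∈ d (insert x S ∪ -(insert x S)) := by
  have hT := symm_sub om hS
  have hxS : insert x S ⊆ E := insert_subset hx hS
  have e : insert y S ∪ -(insert y S) = insert y (insert (-y) (S ∪ -S)) := by
    ext t; simp; tauto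
  rw [e] at h
  have hy' := om.neg_mem _ hy
  rcases om_split om hT hy hx h with s | s
  · have := om.exchange3 (S ∪ -S) hT x hx (-y) hy' (by
      convert s using 2; ext t; simp <;> tauto) h'
    have h2 : -y ∈ d (insert x S ∪ -(insert x S)) := by
      refine om.cx_mono _ _ ?_ (symm_sub om hxS) this
      intro t; simp; tauto
    simpa using cl_neg om hxS h2
  · have := om.exchange3 (S ∪ -S) hT x hx y hy (by
      convert s using 2; ext t; simp <;> tauto) h'
    refine om.cx_mono _ _ ?_ (symm_sub om hxS) this
    intro t; simp; tauto

theorem cl_steinitz (om : IsOrientedMatroidOn E d) {a b c y1 y2 y3 : V}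
    (ha : a ∈ E) (hb : b ∈ E) (hc : c ∈ E) (h1 : y1 ∈ E) (h2 : y2 ∈ E) (h3 : y3 ∈ E)
    (hspan : E ⊆ d (({a, b, c} : Set V) ∪ -({a, b, c} : Set V)))
    (i1 : y1 ∉ d ((∅ : Set V) ∪ -(∅ : Set V)))
    (i2 : y2 ∉ d (({y1} : Set V) ∪ -({y1} : Set V)))
    (i3 : y3 ∉ d (({y1, y2} : Set V) ∪ -({y1, y2} : Set V))) :
    E ⊆ d (({y1, y2, y3} : Set V) ∪ -({y1, y2, y3} : Set V)) := by
  have s1 : ∀ {p : V}, p ∈ E → ({p} : Set V) ⊆ E := fun hp => singleton_subset_iff.mpr hp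
  have s2 : ∀ {p q : V}, p ∈ E → q ∈ E → ({p, q} : Set V) ⊆ E :=
    fun hp hq => insert_subset hp (s1 hq)
  have s3 : ∀ {p q r : V}, p ∈ E → q ∈ E → r ∈ E → ({p, q, r} : Set V) ⊆ E :=
    fun hp hq hr => insert_subset hp (s2 hq hr)
  have rebase : ∀ {p q r p' q' r' : V}, p ∈ E → q ∈ E → r ∈ E →
      E ⊆ d (({p', q', r'} : Set V) ∪ -({p', q', r'} : Set V)) →
      p' ∈ d (({p, q, r} : Set V) ∪ -({p, q, r} : Set V)) →
      q' ∈ d (({p, q, r} : Set V) ∪ -({p, q, r} : Set V)) →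
      r' ∈ d (({p, q, r} : Set V) ∪ -({p, q, r} : Set V)) →
      E ⊆ d (({p, q, r} : Set V) ∪ -({p, q, r} : Set V)) := by
    intro p q r p' q' r' hp hq hr h hp' hq' hr'
    refine h.trans (cl_sub om (s3 hp hq hr) ?_)
    exact insert_subset hp' (insert_subset hq' (singleton_subset_iff.mpr hr'))
  have mono : ∀ {S T : Set V} {t : V}, T ⊆ E → S ⊆ T → t ∈ d (S ∪ -S) → t ∈ d (T ∪ -T) := by
    intro S T t hT hST ht
    exact cl_sub om hT (fun u hu => cl_mem om hT (hST hu)) ht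
  have st1 : ∃ p ∈ E, ∃ q ∈ E, E ⊆ d (({y1, p, q} : Set V) ∪ -({y1, p, q} : Set V)) := by
    by_cases k1 : y1 ∈ d (({a, b} : Set V) ∪ -({a, b} : Set V))
    · by_cases k2 : y1 ∈ d (({a} : Set V) ∪ -({a} : Set V))
      · have e := cl_exch om (empty_subset E) h1 ha (by simpa using k2) i1
        refine ⟨b, hb, c, hc, rebase h1 hb hc hspan ?_ ?_ ?_⟩
        · refine mono (s3 h1 hb hc) ?_ e
          intro t; simp; tauto
        · exact cl_mem om (s3 h1 hb hc) (by simp)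
        · exact cl_mem om (s3 h1 hb hc) (by simp)
      · have e := cl_exch om (s1 ha) h1 hb (by rwa [Set.pair_comm] at k1) k2
        refine ⟨a, ha, c, hc, rebase h1 ha hc hspan ?_ ?_ ?_⟩
        · exact cl_mem om (s3 h1 ha hc) (by simp)
        · refine mono (s3 h1 ha hc) ?_ e
          intro t; simp; tauto
        · exact cl_mem om (s3 h1 ha hc) (by simp)
    · have e := cl_exch om (s2 ha hb) h1 hc (by
        have := hspan h1
        refine mono (s3 hc ha hb) ?_ this
        intro t; simp; tauto) k1
      refine ⟨a, ha, b, hb, rebase h1 ha hb hspan ?_ ?_ ?_⟩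
      · exact cl_mem om (s3 h1 ha hb) (by simp)
      · exact cl_mem om (s3 h1 ha hb) (by simp)
      · exact e
  obtain ⟨p, hp, q, hq, hs1⟩ := st1
  have st2 : ∃ r ∈ E, E ⊆ d (({y1, y2, r} : Set V) ∪ -({y1, y2, r} : Set V)) := by
    by_cases k1 : y2 ∈ d (({y1, p} : Set V) ∪ -({y1, p} : Set V))
    · have e := cl_exch om (s1 h1) h2 hp (by rwa [Set.pair_comm] at k1) i2
      refine ⟨q, hq, rebase h1 h2 hq hs1 ?_ ?_ ?_⟩
      · exact cl_mem om (s3 h1 h2 hq) (by simp)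
      · refine mono (s3 h1 h2 hq) ?_ e
        intro t; simp; tauto
      · exact cl_mem om (s3 h1 h2 hq) (by simp)
    · have e := cl_exch om (s2 h1 hp) h2 hq (by
        have := hs1 h2
        refine mono (s3 hq h1 hp) ?_ this
        intro t; simp; tauto) k1
      refine ⟨p, hp, rebase h1 h2 hp hs1 ?_ ?_ ?_⟩
      · exact cl_mem om (s3 h1 h2 hp) (by simp)
      · exact cl_mem om (s3 h1 h2 hp) (by simp)
      · refine mono (s3 h1 h2 hp) ?_ e
        intro t; simp; tauto
  obtain ⟨r, hr, hs2⟩ := st2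
  have e := cl_exch om (s2 h1 h2) h3 hr (by
    have := hs2 h3
    refine mono (s3 hr h1 h2) ?_ this
    intro t; simp; tauto) i3
  refine rebase h1 h2 h3 hs2 ?_ ?_ ?_
  · exact cl_mem om (s3 h1 h2 h3) (by simp)
  · exact cl_mem om (s3 h1 h2 h3) (by simp)
  · refine mono (s3 h1 h2 h3) ?_ e
    intro t; simp; tauto

end OMLemmas

section ConeLemmas

theorem cone_mono {X Y : Set V} (h : X ⊆ Y) : cone X ⊆ cone Y := by
  rintro v ⟨n, c, x, hc, hx, rfl⟩
  exact ⟨n, c, x, hc, fun i => h (hx i), rfl⟩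

theorem cone_of_sum {X : Set V} {Y : Finset V} (hY : ↑Y ⊆ X) {w : V → ℝ}
    (hw : ∀ y ∈ Y, 0 ≤ w y) : ∑ y ∈ Y, w y • y ∈ cone X := by
  refine ⟨Y.card, fun i => w (Y.equivFin.symm i), fun i => (Y.equivFin.symm i : V), ?_, ?_, ?_⟩
  · intro i; exact hw _ (Y.equivFin.symm i).2
  · intro i; exact hY (Y.equivFin.symm i).2
  · rw [Equiv.sum_comp Y.equivFin.symm (fun y : Y => w (y : V) • (y : V))]
    exact (Finset.sum_coe_sort Y (fun y => w y • y)).symm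

theorem sum_of_cone {X : Set V} {v : V} (h : v ∈ cone X) :
    ∃ (Y : Finset V) (w : V → ℝ), ↑Y ⊆ X ∧ (∀ y, 0 ≤ w y) ∧ v = ∑ y ∈ Y, w y • y := by
  classical
  obtain ⟨n, c, x, hc, hx, rfl⟩ := h
  refine ⟨Finset.univ.image x, fun y => ∑ i ∈ Finset.univ.filter (fun i => x i = y), c i,
    ?_, ?_, ?_⟩
  · intro y hy
    simp at hy
    obtain ⟨i, rfl⟩ := hy
    exact hx i
  · intro y
    exact Finset.sum_nonneg (fun i _ => hc i)
  · rw [← Finset.sum_fiberwise_of_maps_to (s := Finset.univ) (t := Finset.univ.image x) (g := x)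
      (fun i _ => Finset.mem_image_of_mem _ (Finset.mem_univ i))]
    refine Finset.sum_congr rfl (fun y _ => ?_)
    rw [Finset.sum_smul]
    refine Finset.sum_congr rfl (fun i hi => ?_)
    simp at hi
    rw [hi]

theorem cone_nonneg {X : Set V} (f : V →ₗ[ℝ] ℝ) (hf : ∀ x ∈ X, 0 ≤ f x) {v : V}
    (hv : v ∈ cone X) : 0 ≤ f v := by
  obtain ⟨n, c, x, hc, hx, rfl⟩ := hv
  rw [map_sum]
  refine Finset.sum_nonneg (fun i _ => ?_)
  rw [map_smul]
  exact mul_nonneg (hc i) (hf _ (hx i))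

theorem cone_pair {p q : V} {s t : ℝ} (hs : 0 ≤ s) (ht : 0 ≤ t) : s • p + t • q ∈ cone {p, q} := by
  refine ⟨2, ![s, t], ![p, q], ?_, ?_, ?_⟩
  · intro i; fin_cases i <;> simpa
  · intro i; fin_cases i <;> simp
  · simp [Fin.sum_univ_two]

theorem cone_triple {p q r : V} {s t u : ℝ} (hs : 0 ≤ s) (ht : 0 ≤ t) (hu : 0 ≤ u) :
    s • p + t • q + u • r ∈ cone {p, q, r} := by
  refine ⟨3, ![s, t, u], ![p, q, r], ?_, ?_, ?_⟩
  · intro i; fin_cases i <;> simpa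
  · intro i; fin_cases i <;> simp
  · simp [Fin.sum_univ_three]

theorem cone_sub_span {X : Set V} {v : V} (hv : v ∈ cone X) : v ∈ Submodule.span ℝ X := by
  obtain ⟨n, c, x, hc, hx, rfl⟩ := hv
  exact Submodule.sum_mem _ (fun i _ => Submodule.smul_mem _ _ (Submodule.subset_span (hx i)))

end ConeLemmas

section Roots

/-- Working context: named simple roots and dual functionals. -/
structure RootCtx (B : LinearMap.BilinForm ℝ V) (Δ : Set V) (a b c : V)
    (f0 f1 f2 : V →ₗ[ℝ] ℝ) : Prop where
  hΔ : Δ = {a, b, c}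
  f0a : f0 a = 1
  f0b : f0 b = 0
  f0c : f0 c = 0
  f1a : f1 a = 0
  f1b : f1 b = 1
  f1c : f1 c = 0
  f2a : f2 a = 0
  f2b : f2 b = 0
  f2c : f2 c = 1
  symm : ∀ u v : V, B u v = B v u
  diag : ∀ α ∈ Δ, B α α = 1

variable {B : LinearMap.BilinForm ℝ V} {Δ : Set V} {a b c : V} {f0 f1 f2 : V →ₗ[ℝ] ℝ}

theorem refl_invol {α : V} (hα : B α α = 1) (v : V) :
    (v - (2 * B v α) • α) - (2 * B (v - (2 * B v α) • α) α) • α = v := by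
  simp only [map_sub, map_smul, LinearMap.sub_apply, LinearMap.smul_apply, smul_eq_mul, hα]
  module

theorem exists_refl (hd : ∀ α ∈ Δ, B α α = 1) {α : V} (hα : α ∈ Δ) :
    ∃ g ∈ weylGroup B Δ, ∀ v : V, g v = v - (2 * B v α) • α := by
  let L : V →ₗ[ℝ] V := LinearMap.id - ((2 : ℝ) • (B.flip α)).smulRight α
  have hL : ∀ v, L v = v - (2 * B v α) • α := by
    intro v
    simp [L]
  have hinv : Function.Involutive L := by
    intro v
    rw [hL, hL]
    exact refl_invol (hd α hα) v
  refine ⟨LinearEquiv.ofInvolutive L hinv, Subgroup.subset_closure ⟨α, hα, fun v => ?_⟩,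
    fun v => ?_⟩
  · exact hL v
  · exact hL v

theorem simple_mem_root {α : V} (hα : α ∈ Δ) : α ∈ rootSystem B Δ :=
  ⟨1, one_mem _, α, hα, rfl⟩

theorem weyl_root {w : V ≃ₗ[ℝ] V} (hw : w ∈ weylGroup B Δ) {v : V} (hv : v ∈ rootSystem B Δ) :
    w v ∈ rootSystem B Δ := by
  obtain ⟨u, hu, α, hα, rfl⟩ := hv
  exact ⟨w * u, mul_mem hw hu, α, hα, rfl⟩

theorem root_ind (hd : ∀ α ∈ Δ, B α α = 1) (Q : V → Prop) (h0 : ∀ α ∈ Δ, Q α)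
    (h1 : ∀ α ∈ Δ, ∀ v ∈ rootSystem B Δ, Q v → Q (v - (2 * B v α) • α)) :
    ∀ v ∈ rootSystem B Δ, Q v := by
  have key : ∀ w ∈ weylGroup B Δ, ∀ v ∈ rootSystem B Δ, Q v ↔ Q (w v) := by
    intro w hw
    unfold weylGroup at hw
    induction hw using Subgroup.closure_induction with
    | mem g hg =>
      intro v hv
      have hgW : g ∈ weylGroup B Δ := Subgroup.subset_closure hg
      obtain ⟨α, hα, hg⟩ := hg
      constructor
      · intro h; rw [hg]; exact h1 α hα v hv h
      · intro h
        have := h1 α hα (g v) (weyl_root hgW hv) h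
        rw [hg, refl_invol (hd α hα)] at this
        exact this
    | one => intro v hv; rfl
    | mul x y hx hy ihx ihy =>
      intro v hv
      rw [ihy v hv, ihx (y v) (weyl_root hy hv)]
      rfl
    | inv x hx ih =>
      intro v hv
      have := ih (x⁻¹ v) (weyl_root (inv_mem hx) hv)
      rw [this]
      have e : x (x⁻¹ v) = v := by
        rw [← LinearEquiv.mul_apply, mul_inv_cancel]; rfl
      rw [e]
  rintro v ⟨w, hw, α, hα, rfl⟩
  exact (key w hw α (simple_mem_root hα)).mp (h0 α hα)

theorem root_span (hd : ∀ α ∈ Δ, B α α = 1) : rootSystem B Δ ⊆ Submodule.span ℝ Δ := by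
  refine root_ind hd _ (fun α hα => Submodule.subset_span hα) ?_
  intro α hα v _ hv
  exact Submodule.sub_mem _ hv (Submodule.smul_mem _ _ (Submodule.subset_span hα))

theorem root_norm (hd : ∀ α ∈ Δ, B α α = 1) (hs : ∀ u v : V, B u v = B v u) :
    ∀ v ∈ rootSystem B Δ, B v v = 1 := by
  refine root_ind hd _ hd ?_
  intro α hα v _ hv
  simp only [map_sub, map_smul, LinearMap.sub_apply, LinearMap.smul_apply, smul_eq_mul, hd α hα, hv,
    hs α v]
  ring

theorem RootCtx.decomp (C : RootCtx B Δ a b c f0 f1 f2) {v : V} (hv : v ∈ Submodule.span ℝ Δ) :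
    v = f0 v • a + f1 v • b + f2 v • c := by
  rw [C.hΔ, Submodule.mem_span_triple] at hv
  obtain ⟨x, y, z, rfl⟩ := hv
  simp [C.f0a, C.f0b, C.f0c, C.f1a, C.f1b, C.f1c, C.f2a, C.f2b, C.f2c]

theorem RootCtx.ma (C : RootCtx B Δ a b c f0 f1 f2) : a ∈ Δ := by rw [C.hΔ]; simp
theorem RootCtx.mb (C : RootCtx B Δ a b c f0 f1 f2) : b ∈ Δ := by rw [C.hΔ]; simp
theorem RootCtx.mc (C : RootCtx B Δ a b c f0 f1 f2) : c ∈ Δ := by rw [C.hΔ]; simp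

theorem RootCtx.cone_iff (C : RootCtx B Δ a b c f0 f1 f2) {v : V}
    (hv : v ∈ Submodule.span ℝ Δ) : v ∈ cone Δ ↔ 0 ≤ f0 v ∧ 0 ≤ f1 v ∧ 0 ≤ f2 v := by
  constructor
  · intro h
    refine ⟨cone_nonneg f0 ?_ h, cone_nonneg f1 ?_ h, cone_nonneg f2 ?_ h⟩ <;>
    · rw [C.hΔ]
      rintro x (rfl | rfl | rfl) <;>
        simp [C.f0a, C.f0b, C.f0c, C.f1a, C.f1b, C.f1c, C.f2a, C.f2b, C.f2c]
  · rintro ⟨h0, h1, h2⟩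
    rw [C.decomp hv, C.hΔ]
    exact cone_triple h0 h1 h2

theorem RootCtx.root_P (C : RootCtx B Δ a b c f0 f1 f2) {m0 m1 m2 K D : ℝ}
    {P : ℝ → ℝ → ℝ → Prop} (N : NiceData (B a b) (B a c) (B b c) m0 m1 m2 K D P) :
    ∀ v ∈ rootSystem B Δ, P (f0 v) (f1 v) (f2 v) := by
  have ha := C.diag a C.ma
  have hb := C.diag b C.mb
  have hc := C.diag c C.mc
  refine root_ind C.diag _ ?_ ?_
  · intro α hα
    rw [C.hΔ] at hα
    rcases hα with rfl | rfl | rfl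
    · rw [C.f0a, C.f1a, C.f2a]; exact N.P0
    · rw [C.f0b, C.f1b, C.f2b]; exact N.P1
    · rw [C.f0c, C.f1c, C.f2c]; exact N.P2
  · intro α hα v hv hP
    have hdec := C.decomp (root_span C.diag hv)
    have hB : ∀ u, B v u = f0 v * B a u + f1 v * B b u + f2 v * B c u := by
      intro u
      conv_lhs => rw [hdec]
      simp
    rw [C.hΔ] at hα
    rcases hα with rfl | rfl | rfl
    · have := N.r0 _ _ _ hP
      convert this using 1
      · simp [C.f0a, hB, ha, C.symm b, C.symm c]; ring
      · simp [C.f1a]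
      · simp [C.f2a]
    · have := N.r1 _ _ _ hP
      convert this using 1
      · simp [C.f0b]
      · simp [C.f1b, hB, hb, C.symm c]; ring
      · simp [C.f2b]
    · have := N.r2 _ _ _ hP
      convert this using 1
      · simp [C.f0c]
      · simp [C.f1c]
      · simp [C.f2c, hB, hc]; ring

theorem RootCtx.pos_or_neg (C : RootCtx B Δ a b c f0 f1 f2) (hN : Nice (B a b) (B a c) (B b c))
    {v : V} (hv : v ∈ rootSystem B Δ) : v ∈ cone Δ ∨ -v ∈ cone Δ := by
  obtain ⟨m0, m1, m2, K, D, P, N⟩ := hN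
  have hs := root_span C.diag hv
  rcases N.sgn _ _ _ (C.root_P N v hv) with h | h
  · left; exact (C.cone_iff hs).mpr h
  · right
    refine (C.cone_iff (Submodule.neg_mem _ hs)).mpr ?_
    simpa using h

theorem finite_zd (D M : ℝ) (hD : 0 < D) :
    {x : ℝ | 0 ≤ x ∧ x ≤ M ∧ ∃ n : ℤ, x = n ∨ x = D * n}.Finite := by
  have h1 : ((fun n : ℤ => (n : ℝ)) '' (Set.Icc 0 ⌈M⌉)).Finite := (Set.finite_Icc _ _).image _
  have h2 : ((fun n : ℤ => D * (n : ℝ)) '' (Set.Icc 0 ⌈M / D⌉)).Finite :=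
    (Set.finite_Icc _ _).image _
  refine (h1.union h2).subset ?_
  rintro x ⟨h0, hM, n, rfl | rfl⟩
  · left
    refine ⟨n, ⟨by exact_mod_cast h0, ?_⟩, rfl⟩
    have : (n : ℝ) ≤ ⌈M⌉ := hM.trans (Int.le_ceil _)
    exact_mod_cast this
  · right
    refine ⟨n, ⟨?_, ?_⟩, rfl⟩
    · have : (0 : ℝ) ≤ n := nonneg_of_mul_nonneg_right h0 hD
      exact_mod_cast this
    · have : (n : ℝ) ≤ M / D := by rw [le_div_iff₀ hD]; linarith
      have : (n : ℝ) ≤ ⌈M / D⌉ := this.trans (Int.le_ceil _)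
      exact_mod_cast this

theorem RootCtx.finite_inv (C : RootCtx B Δ a b c f0 f1 f2) {m0 m1 m2 K D : ℝ}
    {P : ℝ → ℝ → ℝ → Prop} (N : NiceData (B a b) (B a c) (B b c) m0 m1 m2 K D P)
    (f : V →ₗ[ℝ] ℝ) (hf : 0 < f (m0 • a + m1 • b + m2 • c)) :
    {v | v ∈ positiveRoots B Δ ∧ f v < 0}.Finite := by
  have hfe : f (m0 • a + m1 • b + m2 • c) = m0 * f a + m1 * f b + m2 * f c := by simp
  rw [hfe] at hf
  set q := m0 * f a + m1 * f b + m2 * f c with hq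
  set T := (|K| * (|f a| + |f b| + |f c|)) / q with hT
  have hT0 : 0 ≤ T := by positivity
  set M := T * (m0 + m1 + m2) + |K| with hM
  have hS := finite_zd D M N.D_pos
  set S := {x : ℝ | 0 ≤ x ∧ x ≤ M ∧ ∃ n : ℤ, x = n ∨ x = D * n} with hSdef
  refine Set.Finite.of_finite_image (f := fun v => (f0 v, f1 v, f2 v))
    ((hS.prod (hS.prod hS)).subset ?_) ?_
  · rintro _ ⟨v, ⟨⟨hv, hvc⟩, hneg⟩, rfl⟩
    have hsp := root_span C.diag hv
    have hP := C.root_P N v hv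
    obtain ⟨p0, p1, p2⟩ := (C.cone_iff hsp).mp hvc
    obtain ⟨i0, i1, i2⟩ := N.int _ _ _ hP
    obtain ⟨k, k0, k1, k2⟩ := N.bdd _ _ _ hP
    have hfv : f v = f0 v * f a + f1 v * f b + f2 v * f c := by
      conv_lhs => rw [C.decomp hsp]
      simp
    have kK := le_abs_self K
    have t0 : |(f0 v - k * m0) * f a| ≤ |K| * |f a| := by
      rw [abs_mul]; exact mul_le_mul_of_nonneg_right (k0.trans kK) (abs_nonneg _)
    have t1 : |(f1 v - k * m1) * f b| ≤ |K| * |f b| := by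
      rw [abs_mul]; exact mul_le_mul_of_nonneg_right (k1.trans kK) (abs_nonneg _)
    have t2 : |(f2 v - k * m2) * f c| ≤ |K| * |f c| := by
      rw [abs_mul]; exact mul_le_mul_of_nonneg_right (k2.trans kK) (abs_nonneg _)
    have kq : k * q ≤ |K| * (|f a| + |f b| + |f c|) := by
      have e : f v = k * q + (f0 v - k * m0) * f a + (f1 v - k * m1) * f b
        + (f2 v - k * m2) * f c := by rw [hfv, hq]; ring
      have := (abs_le.mp t0).1
      have := (abs_le.mp t1).1
      have := (abs_le.mp t2).1
      linarith
    have kT : k ≤ T := by rw [hT, le_div_iff₀ hf]; exact kq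
    have l0 : k * m0 ≤ T * m0 := mul_le_mul_of_nonneg_right kT N.m0_nn
    have l1 : k * m1 ≤ T * m1 := mul_le_mul_of_nonneg_right kT N.m1_nn
    have l2 : k * m2 ≤ T * m2 := mul_le_mul_of_nonneg_right kT N.m2_nn
    have n0 : 0 ≤ T * m0 := mul_nonneg hT0 N.m0_nn
    have n1 : 0 ≤ T * m1 := mul_nonneg hT0 N.m1_nn
    have n2 : 0 ≤ T * m2 := mul_nonneg hT0 N.m2_nn
    have a0 := (abs_le.mp k0).2
    have a1 := (abs_le.mp k1).2
    have a2 := (abs_le.mp k2).2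
    refine ⟨⟨p0, ?_, i0⟩, ⟨p1, ?_, i1⟩, ⟨p2, ?_, i2⟩⟩
    · simp only [hM]; linarith
    · simp only [hM]; linarith
    · simp only [hM]; linarith
  · rintro u ⟨⟨hu, _⟩, _⟩ v ⟨⟨hv, _⟩, _⟩ huv
    simp only [Prod.mk.injEq] at huv
    rw [C.decomp (root_span C.diag hu), C.decomp (root_span C.diag hv), huv.1, huv.2.1, huv.2.2]

/-- A simple reflection permutes the positive roots other than its own simple root. -/
theorem RootCtx.refl_pos (C : RootCtx B Δ a b c f0 f1 f2) (hN : Nice (B a b) (B a c) (B b c))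
    {α : V} (hα : α ∈ Δ) {g : V ≃ₗ[ℝ] V} (hgW : g ∈ weylGroup B Δ)
    (hg : ∀ v : V, g v = v - (2 * B v α) • α) {v : V} (hv : v ∈ positiveRoots B Δ)
    (hne : v ≠ α) : g v ∈ positiveRoots B Δ := by
  obtain ⟨hv, hvc⟩ := hv
  have hgv := weyl_root hgW hv
  refine ⟨hgv, ?_⟩
  rcases C.pos_or_neg hN hgv with h | h
  · exact h
  exfalso
  have hsp := root_span C.diag hv
  have hnorm := root_norm C.diag C.symm v hv
  obtain ⟨p0, p1, p2⟩ := (C.cone_iff hsp).mp hvc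
  obtain ⟨q0, q1, q2⟩ := (C.cone_iff (Submodule.neg_mem _ (root_span C.diag hgv))).mp h
  have hdec := C.decomp hsp
  have hα1 := C.diag α hα
  have fin : ∀ t : ℝ, 0 ≤ t → v = t • α → False := by
    intro t ht hvt
    rw [hvt] at hnorm
    simp [hα1] at hnorm
    have : t = 1 := by nlinarith
    rw [this, one_smul] at hvt
    exact hne hvt
  rw [hg] at q0 q1 q2
  rw [C.hΔ] at hα
  rcases hα with rfl | rfl | rfl
  · simp [C.f0a, C.f1a, C.f2a] at q0 q1 q2
    refine fin (f0 v) p0 ?_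
    have z1 : f1 v = 0 := by linarith
    have z2 : f2 v = 0 := by linarith
    simpa [z1, z2] using hdec
  · simp [C.f0b, C.f1b, C.f2b] at q0 q1 q2
    refine fin (f1 v) p1 ?_
    have z1 : f0 v = 0 := by linarith
    have z2 : f2 v = 0 := by linarith
    simpa [z1, z2] using hdec
  · simp [C.f0c, C.f1c, C.f2c] at q0 q1 q2
    refine fin (f2 v) p2 ?_
    have z1 : f0 v = 0 := by linarith
    have z2 : f1 v = 0 := by linarith
    simpa [z1, z2] using hdec

theorem RootCtx.chamber (C : RootCtx B Δ a b c f0 f1 f2) {m0 m1 m2 K D : ℝ}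
    {P : ℝ → ℝ → ℝ → Prop} (N : NiceData (B a b) (B a c) (B b c) m0 m1 m2 K D P) :
    ∀ (n : ℕ) (f : V →ₗ[ℝ] ℝ), 0 < f (m0 • a + m1 • b + m2 • c) →
      {v | v ∈ positiveRoots B Δ ∧ f v < 0}.ncard = n →
      ∃ w ∈ weylGroup B Δ, ∀ α ∈ Δ, 0 ≤ f (w α) := by
  have hN : Nice (B a b) (B a c) (B b c) := ⟨m0, m1, m2, K, D, P, N⟩
  intro n
  induction n using Nat.strong_induction_on with
  | _ n ih =>
  intro f hf hn
  by_cases hall : ∀ α ∈ Δ, 0 ≤ f α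
  · exact ⟨1, one_mem _, hall⟩
  push Not at hall
  obtain ⟨α, hα, hneg⟩ := hall
  obtain ⟨g, hgW, hg⟩ := exists_refl C.diag hα
  have gg : ∀ v, g (g v) = v := by
    intro v
    rw [hg (g v), hg v]
    exact refl_invol (C.diag α hα) v
  have hrad : B (m0 • a + m1 • b + m2 • c) α = 0 := by
    rw [C.hΔ] at hα
    have ha := C.diag a C.ma
    have hb := C.diag b C.mb
    have hc := C.diag c C.mc
    have r0 := N.rad0
    have r1 := N.rad1
    have r2 := N.rad2
    rcases hα with rfl | rfl | rfl
    · simp [ha, C.symm b, C.symm c]; linarith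
    · simp [hb, C.symm c]; linarith
    · simp [hc]; linarith
  have hf' : 0 < (f ∘ₗ g.toLinearMap) (m0 • a + m1 • b + m2 • c) := by
    rw [LinearMap.comp_apply, LinearEquiv.coe_coe, hg, hrad]
    simpa using hf
  have hαpos : α ∈ positiveRoots B Δ := by
    refine ⟨simple_mem_root hα, ?_⟩
    have : (∑ y ∈ ({α} : Finset V), (1 : ℝ) • y) ∈ cone Δ :=
      cone_of_sum (by simpa using hα) (fun _ _ => zero_le_one)
    simpa using this
  have hgα : g α = -α := by
    rw [hg, C.diag α hα]; module
  have hlt : {v | v ∈ positiveRoots B Δ ∧ (f ∘ₗ g.toLinearMap) v < 0}.ncard < n := by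
    rw [← hn]
    have hfin := C.finite_inv N f hf
    have hsub : {v | v ∈ positiveRoots B Δ ∧ (f ∘ₗ g.toLinearMap) v < 0} ⊆
        g '' ({v | v ∈ positiveRoots B Δ ∧ f v < 0} \ {α}) := by
      rintro v ⟨hv, hfv⟩
      rw [LinearMap.comp_apply, LinearEquiv.coe_coe] at hfv
      have hvα : v ≠ α := by
        rintro rfl
        rw [hgα, map_neg] at hfv
        linarith
      refine ⟨g v, ⟨⟨C.refl_pos hN hα hgW hg hv hvα, hfv⟩, ?_⟩, gg v⟩
      intro h
      have h : g v = α := h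
      have : v = -α := by rw [← gg v, h, hgα]
      have h1 := hv.2
      rw [this] at h1
      have hs : α ∈ Submodule.span ℝ Δ := Submodule.subset_span hα
      have u1 := (C.cone_iff hs).mp hαpos.2
      have u2 := (C.cone_iff (Submodule.neg_mem _ hs)).mp h1
      simp only [map_neg] at u2
      have z0 : f0 α = 0 := by linarith
      have z1 : f1 α = 0 := by linarith
      have z2 : f2 α = 0 := by linarith
      have hz := C.decomp hs
      rw [z0, z1, z2] at hz
      have hd1 := C.diag α hα
      have hz' : α = 0 := by simpa using hz
      rw [hz'] at hd1
      simp at hd1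
    calc _ ≤ (g '' ({v | v ∈ positiveRoots B Δ ∧ f v < 0} \ {α})).ncard :=
          Set.ncard_le_ncard hsub (hfin.diff.image _)
      _ ≤ ({v | v ∈ positiveRoots B Δ ∧ f v < 0} \ {α}).ncard := Set.ncard_image_le hfin.diff
      _ < _ := Set.ncard_diff_singleton_lt_of_mem ⟨hαpos, hneg⟩ hfin
  obtain ⟨w, hw, hwα⟩ := ih _ hlt _ hf' rfl
  exact ⟨g * w, mul_mem hgW hw, fun β hβ => hwα β hβ⟩

end Roots

section Sep

variable {B : LinearMap.BilinForm ℝ V} {Δ : Set V} {a b c : V} {f0 f1 f2 : V →ₗ[ℝ] ℝ}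
  {d : Set V → Set V}

theorem no_sep_pos (C : RootCtx B Δ a b c f0 f1 f2) {m0 m1 m2 K D : ℝ}
    {P : ℝ → ℝ → ℝ → Prop} (N : NiceData (B a b) (B a c) (B b c) m0 m1 m2 K D P)
    (hd : IsOMRS B Δ d) {Y : Set V} (hY : Y ⊆ rootSystem B Δ) {g : V}
    (f : V →ₗ[ℝ] ℝ) (hf : 0 < f (m0 • a + m1 • b + m2 • c))
    (hfY : ∀ y ∈ Y, 0 < f y) (hg : f g < 0) : g ∉ d Y := by
  intro hgd
  have hN : Nice (B a b) (B a c) (B b c) := ⟨m0, m1, m2, K, D, P, N⟩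
  obtain ⟨w, hw, hwf⟩ := C.chamber N _ f hf rfl
  have hpos : ∀ v ∈ cone Δ, 0 ≤ f (w v) := fun v hv =>
    cone_nonneg (f ∘ₗ (w : V →ₗ[ℝ] V)) hwf hv
  have hP : positiveRoots B Δ ⊆ rootSystem B Δ := inter_subset_left
  have hPw : ⇑w '' positiveRoots B Δ ⊆ rootSystem B Δ := by
    rintro _ ⟨v, hv, rfl⟩
    exact weyl_root hw (hP hv)
  have hYw : Y ⊆ ⇑w '' positiveRoots B Δ := by
    intro y hy
    have e : w (w⁻¹ y) = y := by
      rw [← LinearEquiv.mul_apply, mul_inv_cancel]; rfl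
    have hr := weyl_root (inv_mem hw) (hY hy)
    refine ⟨w⁻¹ y, ⟨hr, ?_⟩, e⟩
    rcases C.pos_or_neg hN hr with h | h
    · exact h
    · exfalso
      have := hpos _ h
      rw [map_neg, e, map_neg] at this
      linarith [hfY y hy]
  have h2 := hd.om.cx_mono _ _ hYw hPw hgd
  rw [hd.equivariant w hw _ hP, hd.positive_closed] at h2
  obtain ⟨v, hv, rfl⟩ := h2
  linarith [hpos v hv.2]

theorem no_sep (C : RootCtx B Δ a b c f0 f1 f2) {m0 m1 m2 K D : ℝ}
    {P : ℝ → ℝ → ℝ → Prop} (N : NiceData (B a b) (B a c) (B b c) m0 m1 m2 K D P)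
    (hd : IsOMRS B Δ d) {Y : Set V} (hfin : Y.Finite) (hY : Y ⊆ rootSystem B Δ) {g : V}
    (f : V →ₗ[ℝ] ℝ)
    (hfY : ∀ y ∈ Y, 0 < f y) (hg : f g < 0) : g ∉ d Y := by
  have key : ∀ f : V →ₗ[ℝ] ℝ, (∀ y ∈ Y, 0 < f y) → f g < 0 →
      f (m0 • a + m1 • b + m2 • c) ≠ 0 → g ∉ d Y := by
    intro f hfY hg hne
    rcases lt_or_gt_of_ne hne with h | h
    · intro hgd
      have hYn : -Y ⊆ rootSystem B Δ := by
        intro y hy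
        have := hd.om.neg_mem _ (hY hy)
        simpa using this
      have : -g ∈ d (-Y) := by
        rw [hd.om.cx_neg Y hY]
        simpa using hgd
      refine no_sep_pos C N hd hYn (-f) (by rw [LinearMap.neg_apply]; linarith) ?_ (by simpa using hg) this
      intro y hy
      have := hfY (-y) hy
      simpa using this
    · exact no_sep_pos C N hd hY f h hfY hg
  by_cases h0 : f (m0 • a + m1 • b + m2 • c) = 0
  · have hev : ∀ u : V, 0 < f u → ∀ᶠ e in nhdsWithin (0 : ℝ) (Ioi 0),
        0 < f u + e * (f0 + f1 + f2) u := by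
      intro u hu
      apply Filter.Eventually.filter_mono nhdsWithin_le_nhds
      have hc : ContinuousAt (fun e : ℝ => f u + e * (f0 + f1 + f2) u) 0 := by fun_prop
      exact hc.eventually (lt_mem_nhds (by simpa using hu))
    have h1 : ∀ᶠ e in nhdsWithin (0 : ℝ) (Ioi 0), ∀ y ∈ Y, 0 < f y + e * (f0 + f1 + f2) y :=
      (Set.Finite.eventually_all hfin).mpr (fun y hy => hev y (hfY y hy))
    have h2 := hev (-g) (by rw [map_neg]; linarith)
    obtain ⟨e, ⟨he1, he2⟩, he0⟩ := ((h1.and h2).and self_mem_nhdsWithin).exists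
    refine key (f + e • (f0 + f1 + f2)) (fun y hy => he1 y hy) ?_ ?_
    · rw [map_neg, map_neg] at he2
      have : (f + e • (f0 + f1 + f2)) g = f g + e * (f0 + f1 + f2) g := rfl
      rw [this]; linarith
    · have he0' : (0 : ℝ) < e := he0
      have : (f + e • (f0 + f1 + f2)) (m0 • a + m1 • b + m2 • c) = e * (m0 + m1 + m2) := by
        rw [LinearMap.add_apply, h0]
        simp [C.f0a, C.f0b, C.f0c, C.f1a, C.f1b, C.f1c, C.f2a, C.f2b, C.f2c]
        ring
      rw [this]
      exact (mul_pos he0' N.m_pos).ne'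
  · exact key f hfY hg h0

/-- Gordan alternative for finite sets. -/
theorem gordan [FiniteDimensional ℝ V] {S : Set V} (hS : S.Finite)
    (h : (0 : V) ∉ convexHull ℝ S) : ∃ f : V →ₗ[ℝ] ℝ, ∀ s ∈ S, 0 < f s := by
  let e : V ≃ₗ[ℝ] (Fin (Module.finrank ℝ V) → ℝ) := (Module.finBasis ℝ V).equivFun
  have h1 : (0 : Fin (Module.finrank ℝ V) → ℝ) ∉ convexHull ℝ (e '' S) := by
    intro h0
    have := (e : V →ₗ[ℝ] (Fin (Module.finrank ℝ V) → ℝ)).image_convexHull S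
    rw [LinearEquiv.coe_coe] at this
    rw [← this] at h0
    obtain ⟨x, hx, hx0⟩ := h0
    rw [LinearEquiv.map_eq_zero_iff] at hx0
    exact h (hx0 ▸ hx)
  obtain ⟨f, u, hu, hf⟩ := geometric_hahn_banach_point_closed (convex_convexHull ℝ (e '' S))
    ((hS.image e).isClosed_convexHull ℝ) h1
  refine ⟨(f : (Fin (Module.finrank ℝ V) → ℝ) →ₗ[ℝ] ℝ) ∘ₗ (e : V →ₗ[ℝ] _), fun s hs => ?_⟩
  have := hf (e s) (subset_convexHull ℝ _ (mem_image_of_mem e hs))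
  simp at hu
  simpa using hu.trans this


theorem cone_of_fintype {ι : Type*} [Fintype ι] {X : Set V} {c : ι → ℝ} {x : ι → V}
    (hc : ∀ i, 0 ≤ c i) (hx : ∀ i, x i ∈ X) : ∑ i, c i • x i ∈ cone X := by
  refine ⟨Fintype.card ι, c ∘ (Fintype.equivFin ι).symm, x ∘ (Fintype.equivFin ι).symm,
    fun i => hc _, fun i => hx _, ?_⟩
  exact (Equiv.sum_comp (Fintype.equivFin ι).symm (fun i => c i • x i)).symm

theorem rank_pair_le (p q : V) : Module.rank ℝ ↥(Submodule.span ℝ ({p, q} : Set V)) ≤ 2 := by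
  classical
  have h := rank_span_finset_le (R := ℝ) ({p, q} : Finset V)
  have h2 : (({p, q} : Finset V).card : Cardinal) ≤ 2 := by
    exact_mod_cast Finset.card_le_two
  have := h.trans h2
  rwa [Finset.coe_pair] at this

theorem cone_triple_inv {x y z v : V} (h : v ∈ cone ({x, y, z} : Set V)) :
    ∃ p q r : ℝ, 0 ≤ p ∧ 0 ≤ q ∧ 0 ≤ r ∧ v = p • x + q • y + r • z := by
  obtain ⟨n, c, u, hc, hu, rfl⟩ := h
  refine Finset.sum_induction (fun i => c i • u i)
    (fun v => ∃ p q r : ℝ, 0 ≤ p ∧ 0 ≤ q ∧ 0 ≤ r ∧ v = p • x + q • y + r • z) ?_ ?_ ?_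
  · rintro _ _ ⟨p, q, r, hp, hq, hr, rfl⟩ ⟨p', q', r', hp', hq', hr', rfl⟩
    exact ⟨p + p', q + q', r + r', by positivity, by positivity, by positivity, by module⟩
  · exact ⟨0, 0, 0, le_rfl, le_rfl, le_rfl, by simp⟩
  · intro i _
    rcases hu i with h | h | h
    · exact ⟨c i, 0, 0, hc i, le_rfl, le_rfl, by simp [h]⟩
    · exact ⟨0, c i, 0, le_rfl, hc i, le_rfl, by simp [h]⟩
    · have h : u i = z := h
      exact ⟨0, 0, c i, le_rfl, le_rfl, hc i, by simp [h]⟩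

theorem neg_mem_pair (hd : IsOMRS B Δ d) {x y z : V} (hx : x ∈ rootSystem B Δ)
    (hy : y ∈ rootSystem B Δ) (hz : z ∈ rootSystem B Δ) {p q r : ℝ} (hp : 0 < p) (hq : 0 ≤ q)
    (hr : 0 ≤ r) (h : p • x + q • y + r • z = 0) : -x ∈ d {y, z} := by
  rw [hd.rank_two {y, z} (by rintro t (rfl | rfl) <;> assumption) (rank_pair_le y z)]
  refine ⟨?_, hd.om.neg_mem x hx⟩
  have e : -x = (q / p) • y + (r / p) • z := by
    have h2 : p⁻¹ • (p • x + q • y + r • z) = 0 := by rw [h, smul_zero]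
    have h3 : p⁻¹ • (p • x + q • y + r • z) = (p⁻¹ * p) • x + (q / p) • y + (r / p) • z := by
      rw [div_eq_mul_inv, div_eq_mul_inv]; module
    rw [h3, inv_mul_cancel₀ hp.ne'] at h2
    rw [one_smul, add_assoc] at h2
    exact neg_eq_of_add_eq_zero_right h2
  rw [e]
  exact cone_pair (by positivity) (by positivity)

theorem d_sub_cone [FiniteDimensional ℝ V] (C : RootCtx B Δ a b c f0 f1 f2) {m0 m1 m2 K D : ℝ}
    {P : ℝ → ℝ → ℝ → Prop} (N : NiceData (B a b) (B a c) (B b c) m0 m1 m2 K D P)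
    (hd : IsOMRS B Δ d) {g : V} (hg : g ∈ rootSystem B Δ) :
    ∀ (n : ℕ) (Y : Finset V), Y.card = n → ↑Y ⊆ rootSystem B Δ → g ∈ d ↑Y → g ∈ cone (↑Y : Set V) := by
  classical
  intro n
  induction n using Nat.strong_induction_on with
  | _ n ih =>
  intro Y hcard hY hgY
  have om := hd.om
  have step : ∀ t ∈ Y, ∀ X : Set V, X ⊆ ↑(Y.erase t) → g ∈ d X → g ∈ cone (↑Y : Set V) := by
    intro t ht X hX hgX
    have hsub : (↑(Y.erase t) : Set V) ⊆ ↑Y := by exact_mod_cast Finset.erase_subset t Y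
    have h1 := om.cx_mono X _ hX (hsub.trans hY) hgX
    exact cone_mono hsub (ih _ (hcard ▸ Finset.card_erase_lt_of_mem ht) (Y.erase t) rfl
      (hsub.trans hY) h1)
  have h0 : (0 : V) ∈ convexHull ℝ (insert (-g) (↑Y : Set V)) := by
    by_contra h
    obtain ⟨f, hf⟩ := gordan (Y.finite_toSet.insert (-g)) h
    refine no_sep C N hd Y.finite_toSet hY f (fun y hy => hf y (mem_insert_of_mem _ hy)) ?_ hgY
    have := hf (-g) (mem_insert _ _)
    rw [map_neg] at this
    linarith
  obtain ⟨ι, _, z, w, hz, hai, hw, hw1, hsum⟩ := eq_pos_convex_span_of_mem_convexHull h0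
  by_cases hex : ∃ i, z i = -g
  · obtain ⟨i, hi⟩ := hex
    have e : g = ∑ j ∈ Finset.univ.erase i, (w j / w i) • z j := by
      rw [← Finset.add_sum_erase _ _ (Finset.mem_univ i), hi] at hsum
      have h2 : w i • g = ∑ j ∈ Finset.univ.erase i, w j • z j := by
        rw [smul_neg] at hsum
        exact (neg_add_eq_zero.mp hsum)
      calc g = (w i)⁻¹ • (w i • g) := by rw [smul_smul, inv_mul_cancel₀ (hw i).ne', one_smul]
        _ = _ := by
          rw [h2, Finset.smul_sum]
          refine Finset.sum_congr rfl (fun j _ => ?_)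
          rw [smul_smul, div_eq_inv_mul]
    rw [e, ← Finset.sum_coe_sort]
    refine cone_of_fintype (fun j => div_nonneg (hw _).le (hw i).le) (fun j => ?_)
    rcases hz (mem_range_self (j : ι)) with h | h
    · exfalso
      have := hai.injective (h.trans hi.symm)
      exact (Finset.mem_erase.mp j.2).1 this
    · exact h
  push Not at hex
  have hzY : ∀ i, z i ∈ Y := by
    intro i
    rcases hz (mem_range_self i) with h | h
    · exact absurd h (hex i)
    · exact h
  have hzΦ : ∀ i, z i ∈ rootSystem B Δ := fun i => hY (hzY i)
  have hΔ3 : Module.finrank ℝ (Submodule.span ℝ Δ) ≤ 3 := by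
    have h := finrank_span_finset_le_card (R := ℝ) ({a, b, c} : Finset V)
    have h2 : (({a, b, c} : Finset V) : Set V) = Δ := by rw [C.hΔ]; simp
    rw [Set.finrank, h2] at h
    exact h.trans Finset.card_le_three
  have hle : Submodule.span ℝ (range z) ≤ Submodule.span ℝ Δ := by
    rw [Submodule.span_le]
    rintro _ ⟨i, rfl⟩
    exact root_span C.diag (hzΦ i)
  by_cases h3 : 3 ≤ Module.finrank ℝ (Submodule.span ℝ (range z))
  · have heq := Submodule.eq_of_le_of_finrank_le hle (hΔ3.trans h3)
    have hgs : g ∈ Submodule.span ℝ (range z) := by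
      rw [heq]; exact root_span C.diag hg
    obtain ⟨k, hk⟩ := (Submodule.mem_span_range_iff_exists_fun ℝ).mp hgs
    have e : g = ∑ i, (k i + (∑ j, |k j| / w j) * w i) • z i := by
      simp_rw [add_smul, Finset.sum_add_distrib, mul_smul, ← Finset.smul_sum, hsum, hk]
      simp
    rw [e]
    refine cone_of_fintype (fun i => ?_) hzY
    have h4 : |k i| / w i ≤ ∑ j, |k j| / w j :=
      Finset.single_le_sum (f := fun j => |k j| / w j)
        (fun j _ => div_nonneg (abs_nonneg _) (hw j).le) (Finset.mem_univ i)
    have h5 := (div_le_iff₀ (hw i)).mp h4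
    linarith [neg_abs_le (k i)]
  push Not at h3
  have hcι : Fintype.card ι ≤ 3 := by
    have h4 := hai.card_le_finrank_succ
    have h5 : vectorSpan ℝ (range z) ≤ Submodule.span ℝ (range z) := by
      rw [vectorSpan_def, Submodule.span_le]
      rintro _ ⟨p, hp, q, hq, rfl⟩
      exact Submodule.sub_mem _ (Submodule.subset_span hp) (Submodule.subset_span hq)
    have h6 := Submodule.finrank_mono h5
    omega
  obtain ⟨k, hk⟩ : ∃ k, Fintype.card ι = k := ⟨_, rfl⟩
  let e : Fin k ≃ ι := (Fintype.equivFinOfCardEq hk).symm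
  have hsum' : ∑ i : Fin k, w (e i) • z (e i) = 0 := by
    rw [← hsum]; exact Equiv.sum_comp e (fun i => w i • z i)
  have hinj : Function.Injective (fun i : Fin k => z (e i)) := hai.injective.comp e.injective
  have hw1' : ∑ i : Fin k, w (e i) = 1 := by
    rw [← hw1]; exact Equiv.sum_comp e w
  rw [hk] at hcι
  clear_value e
  clear hk
  interval_cases k
  · simp at hw1'
  · simp at hsum' hw1'
    rw [hw1'] at hsum'
    replace hsum' : z (e 0) = 0 := by simpa using hsum'
    have := root_norm C.diag C.symm _ (hzΦ (e 0))
    rw [hsum'] at this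
    simp at this
  · rw [Fin.sum_univ_two] at hsum'
    have hne : z (e 0) ≠ z (e 1) := fun h => absurd (hinj h) (by decide)
    have h1 := neg_mem_pair hd (hzΦ (e 0)) (hzΦ (e 1)) (hzΦ (e 1)) (hw (e 0)) (hw (e 1)).le
      (le_refl 0) (by rw [zero_smul, add_zero]; exact hsum')
    rw [Set.pair_eq_singleton, hd.reduced.2 _ (hzΦ (e 1))] at h1
    have h1 : -z (e 0) = z (e 1) := h1
    have hY0 := hzY (e 0)
    have hY1 := hzY (e 1)
    have hΦ0 := hzΦ (e 0)
    generalize z (e 0) = y at *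
    rw [← h1] at hY1 hne
    have hZ : (↑Y : Set V) \ {y, -y} ⊆ rootSystem B Δ := sdiff_subset.trans hY
    have h2 : g ∈ d (insert y (insert (-y) ((↑Y : Set V) \ {y, -y}))) := by
      convert hgY using 2
      ext t; simp
      constructor
      · rintro (rfl | rfl | h)
        exacts [hY0, hY1, h.1]
      · intro h; tauto
    rcases om_split om hZ hΦ0 hg h2 with h | h
    · refine step (-y) hY1 _ ?_ h
      intro t; simp; rintro (rfl | h)
      · exact ⟨hY0, hne⟩
      · tauto
    · refine step y hY0 _ ?_ h
      intro t; simp; rintro (rfl | h)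
      · exact ⟨hY1, hne.symm⟩
      · tauto
  · rw [Fin.sum_univ_three] at hsum'
    have hne01 : z (e 0) ≠ z (e 1) := fun h => absurd (hinj h) (by decide)
    have hne02 : z (e 0) ≠ z (e 2) := fun h => absurd (hinj h) (by decide)
    have hne12 : z (e 1) ≠ z (e 2) := fun h => absurd (hinj h) (by decide)
    have r1 := neg_mem_pair hd (hzΦ (e 0)) (hzΦ (e 1)) (hzΦ (e 2)) (hw (e 0)) (hw (e 1)).le
      (hw (e 2)).le hsum'
    have r2 := neg_mem_pair hd (hzΦ (e 1)) (hzΦ (e 0)) (hzΦ (e 2)) (hw (e 1)) (hw (e 0)).le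
      (hw (e 2)).le (by rw [← hsum']; abel)
    have r3 := neg_mem_pair hd (hzΦ (e 2)) (hzΦ (e 0)) (hzΦ (e 1)) (hw (e 2)) (hw (e 0)).le
      (hw (e 1)).le (by rw [← hsum']; abel)
    have hY0 := hzY (e 0)
    have hY1 := hzY (e 1)
    have hY2 := hzY (e 2)
    have hΦ0 := hzΦ (e 0)
    have hΦ1 := hzΦ (e 1)
    have hΦ2 := hzΦ (e 2)
    generalize z (e 0) = y0 at *
    generalize z (e 1) = y1 at *
    generalize z (e 2) = y2 at *
    have hZ : (↑Y : Set V) \ {y0, y1, y2} ⊆ rootSystem B Δ := sdiff_subset.trans hY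
    have h2 : g ∈ d (insert y0 (insert y1 (insert y2 ((↑Y : Set V) \ {y0, y1, y2})))) := by
      convert hgY using 2
      ext t; simp
      constructor
      · rintro (rfl | rfl | rfl | h)
        exacts [hY0, hY1, hY2, h.1]
      · intro h; tauto
    rcases om_triple om hZ hΦ0 hΦ1 hΦ2 hg r1 r2 r3 h2 with h | h | h
    · refine step y2 hY2 _ ?_ h
      intro t; simp; rintro (rfl | rfl | h) <;> tauto
    · refine step y1 hY1 _ ?_ h
      intro t; simp; rintro (rfl | rfl | h) <;> tauto
    · refine step y0 hY0 _ ?_ h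
      intro t; simp; rintro (rfl | rfl | h) <;> tauto

end Sep
section Conv

variable {B : LinearMap.BilinForm ℝ V} {Δ : Set V} {a b c : V} {f0 f1 f2 : V →ₗ[ℝ] ℝ}
  {d : Set V → Set V}

theorem root_sub_cl (C : RootCtx B Δ a b c f0 f1 f2) (hd : IsOMRS B Δ d) :
    rootSystem B Δ ⊆ d ({a, b, c} ∪ -{a, b, c}) := by
  have om := hd.om
  have hΔΦ : Δ ⊆ rootSystem B Δ := fun α hα => simple_mem_root hα
  have hS : ({a, b, c} : Set V) ∪ -{a, b, c} ⊆ rootSystem B Δ := symm_sub om (C.hΔ ▸ hΔΦ)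
  refine root_ind C.diag _ ?_ ?_
  · intro α hα
    refine om.le_cx _ hS (Or.inl ?_)
    rw [← C.hΔ]; exact hα
  · intro α hα v hv hvd
    obtain ⟨s, hsW, hs⟩ := exists_refl C.diag hα
    have hsv : v - (2 * B v α) • α ∈ rootSystem B Δ := hs v ▸ weyl_root hsW hv
    have hαd : α ∈ d ({a, b, c} ∪ -{a, b, c}) := om.le_cx _ hS (Or.inl (C.hΔ ▸ hα))
    have hnd : -α ∈ d ({a, b, c} ∪ -{a, b, c}) :=
      om.le_cx _ hS (Or.inr (by rw [Set.mem_neg, neg_neg]; exact C.hΔ ▸ hα))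
    have gen : ∀ β ∈ d ({a, b, c} ∪ -{a, b, c}), ∀ t : ℝ, 0 ≤ t →
        v - (2 * B v α) • α = (1 : ℝ) • v + t • β →
        v - (2 * B v α) • α ∈ d ({a, b, c} ∪ -{a, b, c}) := by
      intro β hβ t ht e
      refine om_sub om (X := {v, β}) hS ?_ ?_
      · rintro x (rfl | rfl) <;> assumption
      · rw [hd.rank_two {v, β} ?_ (rank_pair_le v β)]
        · refine ⟨?_, hsv⟩
          rw [e]
          exact cone_pair zero_le_one ht
        · rintro x (rfl | rfl)
          · exact hv
          · exact om.cx_le_ground _ hS hβ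
    rcases le_total 0 (B v α) with h | h
    · exact gen (-α) hnd (2 * B v α) (by positivity) (by module)
    · exact gen α hαd (-(2 * B v α)) (by linarith) (by module)

theorem pair_span_not (hd : IsOMRS B Δ d) {x y z : V} (hx : x ∈ rootSystem B Δ)
    (hy : y ∈ rootSystem B Δ) (hz : ∀ p q : ℝ, p • x + q • y ≠ z) :
    z ∉ d ({x, y} ∪ -{x, y}) := by
  have hS : ({x, y} : Set V) ⊆ rootSystem B Δ := by rintro t (rfl | rfl) <;> assumption
  have hspan : Submodule.span ℝ (({x, y} : Set V) ∪ -{x, y}) = Submodule.span ℝ {x, y} := by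
    apply le_antisymm
    · rw [Submodule.span_le]
      rintro t (ht | ht)
      · exact Submodule.subset_span ht
      · have := Submodule.neg_mem _ (Submodule.subset_span (R := ℝ) (Set.mem_neg.mp ht))
        rwa [neg_neg] at this
    · exact Submodule.span_mono subset_union_left
  intro h
  rw [hd.rank_two _ (symm_sub hd.om hS) (by rw [hspan]; exact rank_pair_le x y)] at h
  have h2 := cone_sub_span h.1
  rw [hspan, Submodule.mem_span_pair] at h2
  obtain ⟨p, q, e⟩ := h2
  exact hz p q e

theorem three_case [FiniteDimensional ℝ V] (C : RootCtx B Δ a b c f0 f1 f2) {m0 m1 m2 K D : ℝ}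
    {P : ℝ → ℝ → ℝ → Prop} (N : NiceData (B a b) (B a c) (B b c) m0 m1 m2 K D P)
    (hd : IsOMRS B Δ d) {g y1 y2 y3 : V} (hg : g ∈ rootSystem B Δ)
    (h1 : y1 ∈ rootSystem B Δ) (h2 : y2 ∈ rootSystem B Δ) (h3 : y3 ∈ rootSystem B Δ)
    (hind : ∀ p q r : ℝ, p • y1 + q • y2 + r • y3 = 0 → p = 0 ∧ q = 0 ∧ r = 0)
    {p q r : ℝ} (hp : 0 < p) (hq : 0 < q) (hr : 0 < r) (e : g = p • y1 + q • y2 + r • y3) :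
    g ∈ d {y1, y2, y3} := by
  classical
  have om := hd.om
  have hΔΦ : Δ ⊆ rootSystem B Δ := fun α hα => simple_mem_root hα
  have hst := cl_steinitz om (hΔΦ C.ma) (hΔΦ C.mb) (hΔΦ C.mc) h1 h2 h3 (root_sub_cl C hd)
    (by simp [hd.reduced.1])
    (by
      have := pair_span_not hd h1 h1 (z := y2) (by
        intro p q h
        have := hind (p + q) (-1) 0 (by rw [← h]; module)
        linarith [this.2.1])
      simpa using this)
    (pair_span_not hd h1 h2 (by
        intro p q h
        have := hind p q (-1) (by rw [← h]; module)
        linarith [this.2.2]))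
  have n1 := om.neg_mem _ h1
  have n2 := om.neg_mem _ h2
  have n3 := om.neg_mem _ h3
  have s0 := hst hg
  have s1 : ∃ u1, (u1 = y1 ∨ u1 = -y1) ∧ g ∈ d {u1, y2, -y2, y3, -y3} := by
    rcases om_split om (Z := {y2, -y2, y3, -y3}) (y := y1) (g := g)
      (by rintro t (rfl | rfl | rfl | rfl) <;> assumption) h1 hg
      (by convert s0 using 2; ext t; simp [neg_eq_iff_eq_neg]; tauto) with h | h
    exacts [⟨_, Or.inl rfl, h⟩, ⟨_, Or.inr rfl, h⟩]
  obtain ⟨u1, hu1, s1⟩ := s1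
  have hu1Φ : u1 ∈ rootSystem B Δ := by rcases hu1 with rfl | rfl <;> assumption
  have s2 : ∃ u2, (u2 = y2 ∨ u2 = -y2) ∧ g ∈ d {u2, u1, y3, -y3} := by
    rcases om_split om (Z := {u1, y3, -y3}) (y := y2) (g := g)
      (by rintro t (rfl | rfl | rfl) <;> assumption) h2 hg
      (by convert s1 using 2; ext t; simp; tauto) with h | h
    exacts [⟨_, Or.inl rfl, h⟩, ⟨_, Or.inr rfl, h⟩]
  obtain ⟨u2, hu2, s2⟩ := s2
  have hu2Φ : u2 ∈ rootSystem B Δ := by rcases hu2 with rfl | rfl <;> assumption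
  have s3 : ∃ u3, (u3 = y3 ∨ u3 = -y3) ∧ g ∈ d {u1, u2, u3} := by
    rcases om_split om (Z := {u1, u2}) (y := y3) (g := g)
      (by rintro t (rfl | rfl) <;> assumption) h3 hg
      (by convert s2 using 2; ext t; simp; tauto) with h | h
    · exact ⟨y3, Or.inl rfl, by convert h using 2; ext t; simp; tauto⟩
    · exact ⟨-y3, Or.inr rfl, by convert h using 2; ext t; simp; tauto⟩
  obtain ⟨u3, hu3, hs⟩ := s3
  have hu3Φ : u3 ∈ rootSystem B Δ := by rcases hu3 with rfl | rfl <;> assumption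
  have hc := d_sub_cone C N hd hg _ {u1, u2, u3} rfl
    (by intro t; simp; rintro (rfl | rfl | rfl) <;> assumption) (by simpa using hs)
  have hc' : g ∈ cone ({u1, u2, u3} : Set V) := by simpa using hc
  obtain ⟨p', q', r', hp', hq', hr', e'⟩ := cone_triple_inv hc'
  have fin : ∀ s1 s2 s3 : ℝ, u1 = s1 • y1 → u2 = s2 • y2 → u3 = s3 • y3 →
      p = p' * s1 ∧ q = q' * s2 ∧ r = r' * s3 := by
    intro s1 s2 s3 e1 e2 e3
    have := hind (p - p' * s1) (q - q' * s2) (r - r' * s3) (by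
      have : (p • y1 + q • y2 + r • y3) - (p' • u1 + q' • u2 + r' • u3) = 0 := by
        rw [← e, ← e', sub_self]
      rw [← this, e1, e2, e3]
      module)
    exact ⟨by linarith [this.1], by linarith [this.2.1], by linarith [this.2.2]⟩
  have hs1 : ∃ s : ℝ, u1 = s • y1 ∧ (u1 = y1 ∨ s = -1) := by
    rcases hu1 with h | h
    · exact ⟨1, by simp [h], Or.inl h⟩
    · exact ⟨-1, by simp [h], Or.inr rfl⟩
  have hs2 : ∃ s : ℝ, u2 = s • y2 ∧ (u2 = y2 ∨ s = -1) := by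
    rcases hu2 with h | h
    · exact ⟨1, by simp [h], Or.inl h⟩
    · exact ⟨-1, by simp [h], Or.inr rfl⟩
  have hs3 : ∃ s : ℝ, u3 = s • y3 ∧ (u3 = y3 ∨ s = -1) := by
    rcases hu3 with h | h
    · exact ⟨1, by simp [h], Or.inl h⟩
    · exact ⟨-1, by simp [h], Or.inr rfl⟩
  obtain ⟨s1, e1, k1⟩ := hs1
  obtain ⟨s2, e2, k2⟩ := hs2
  obtain ⟨s3, e3, k3⟩ := hs3
  obtain ⟨c1, c2, c3⟩ := fin s1 s2 s3 e1 e2 e3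
  have l1 : u1 = y1 := k1.resolve_right (by rintro rfl; linarith)
  have l2 : u2 = y2 := k2.resolve_right (by rintro rfl; linarith)
  have l3 : u3 = y3 := k3.resolve_right (by rintro rfl; linarith)
  rwa [l1, l2, l3] at hs

theorem cone_sub_d [FiniteDimensional ℝ V] (C : RootCtx B Δ a b c f0 f1 f2) {m0 m1 m2 K D : ℝ}
    {P : ℝ → ℝ → ℝ → Prop} (N : NiceData (B a b) (B a c) (B b c) m0 m1 m2 K D P)
    (hd : IsOMRS B Δ d) {g : V} (hg : g ∈ rootSystem B Δ) :
    ∀ (n : ℕ) (Y : Finset V) (w : V → ℝ), Y.card = n → ↑Y ⊆ rootSystem B Δ →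
      (∀ y ∈ Y, 0 ≤ w y) → g = ∑ y ∈ Y, w y • y → g ∈ d ↑Y := by
  classical
  intro n
  induction n using Nat.strong_induction_on with
  | _ n ih =>
  intro Y w hcard hY hw hgY
  have step : ∀ (t : V) (w' : V → ℝ), t ∈ Y → (∀ y ∈ Y, 0 ≤ w' y) → g = ∑ y ∈ Y, w' y • y →
      w' t = 0 → g ∈ d ↑Y := by
    intro t w' ht hw' hs h0
    have hsub : (↑(Y.erase t) : Set V) ⊆ ↑Y := by exact_mod_cast Finset.erase_subset t Y
    refine hd.om.cx_mono _ _ hsub hY (ih _ (hcard ▸ Finset.card_erase_lt_of_mem ht) (Y.erase t) w'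
      rfl (hsub.trans hY) (fun y hy => hw' y (Finset.mem_of_mem_erase hy)) ?_)
    rw [hs, ← Finset.add_sum_erase _ _ ht, h0, zero_smul, zero_add]
  by_cases hz : ∃ t ∈ Y, w t = 0
  · obtain ⟨t, ht, h0⟩ := hz
    exact step t w ht hw hgY h0
  push Not at hz
  have hpos : ∀ y ∈ Y, 0 < w y := fun y hy => lt_of_le_of_ne (hw y hy) (hz y hy).symm
  by_cases hdep : ∃ k : V → ℝ, ∑ y ∈ Y, k y • y = 0 ∧ ∃ t ∈ Y, 0 < k t
  · obtain ⟨k, hk, t, ht, hkt⟩ := hdep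
    obtain ⟨t1, ht1, hmin⟩ := Finset.exists_min_image (Y.filter (fun y => 0 < k y))
      (fun y => w y / k y) ⟨t, Finset.mem_filter.mpr ⟨ht, hkt⟩⟩
    obtain ⟨ht1, hk1⟩ := Finset.mem_filter.mp ht1
    have hq : 0 < w t1 / k t1 := div_pos (hpos t1 ht1) hk1
    refine step t1 (fun y => w y - w t1 / k t1 * k y) ht1 ?_ ?_ ?_
    · intro y hy
      rcases le_or_gt (k y) 0 with h | h
      · have := mul_nonpos_of_nonneg_of_nonpos hq.le h
        linarith [hpos y hy]
      · have := hmin y (Finset.mem_filter.mpr ⟨hy, h⟩)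
        have := (le_div_iff₀ h).mp this
        linarith
    · simp_rw [sub_smul, Finset.sum_sub_distrib, mul_smul, ← Finset.smul_sum, hk]
      simpa using hgY
    · show w t1 - w t1 / k t1 * k t1 = 0
      rw [div_mul_cancel₀ _ hk1.ne', sub_self]
  have hind : ∀ k : V → ℝ, ∑ y ∈ Y, k y • y = 0 → ∀ t ∈ Y, k t = 0 := by
    intro k hk t ht
    by_contra hne
    rcases lt_or_gt_of_ne hne with h | h
    · exact hdep ⟨fun y => - k y, by simp [hk], t, ht, by linarith⟩
    · exact hdep ⟨k, hk, t, ht, h⟩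
  have hli : LinearIndepOn ℝ id (↑Y : Set V) := by
    rw [linearIndepOn_finset_iff]
    exact hind
  have hc3 : Y.card ≤ 3 := by
    have hΔ3 : Module.finrank ℝ (Submodule.span ℝ Δ) ≤ 3 := by
      have h := finrank_span_finset_le_card (R := ℝ) ({a, b, c} : Finset V)
      have h2 : (({a, b, c} : Finset V) : Set V) = Δ := by rw [C.hΔ]; simp
      rw [Set.finrank, h2] at h
      exact h.trans Finset.card_le_three
    have h1 := finrank_span_finset_eq_card hli
    have h2 : Submodule.span ℝ (↑Y : Set V) ≤ Submodule.span ℝ Δ :=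
      Submodule.span_le.mpr (hY.trans (root_span C.diag))
    have h3 := Submodule.finrank_mono h2
    omega
  by_cases hc2 : Y.card ≤ 2
  · rw [hd.rank_two _ hY]
    · refine ⟨?_, hg⟩
      rw [hgY]
      exact cone_of_sum subset_rfl hw
    · refine (rank_span_finset_le Y).trans ?_
      exact_mod_cast hc2
  obtain ⟨y1, y2, y3, h12, h13, h23, rfl⟩ := Finset.card_eq_three.mp (by omega : Y.card = 3)
  have hsum3 : ∀ k : V → ℝ, ∑ y ∈ ({y1, y2, y3} : Finset V), k y • y =
      k y1 • y1 + k y2 • y2 + k y3 • y3 := by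
    intro k
    rw [Finset.sum_insert (by simp [h12, h13]), Finset.sum_insert (by simp [h23]),
      Finset.sum_singleton, add_assoc]
  rw [hsum3] at hgY
  have := three_case C N hd hg (hY (by simp)) (hY (by simp)) (hY (by simp)) (y1 := y1) (y2 := y2)
    (y3 := y3) ?_ (hpos y1 (by simp)) (hpos y2 (by simp)) (hpos y3 (by simp)) hgY
  · simpa using this
  · intro p q r h
    have := hind (fun y => if y = y1 then p else if y = y2 then q else r) (by
      rw [hsum3]; simpa [h12.symm, h13.symm, h23.symm] using h)
    have a1 := this y1 (by simp)
    have a2 := this y2 (by simp)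
    have a3 := this y3 (by simp)
    simp [h12.symm, h13.symm, h23.symm] at a1 a2 a3
    exact ⟨a1, a2, a3⟩

end Conv

/-- a rank 3 affine based root system (positive semidefinite but not
positive definite form on the span of `Δ`) has a unique OMRS structure. -/
theorem rank3_affine_unique_OMRS [FiniteDimensional ℝ V]
    (B : LinearMap.BilinForm ℝ V) (Δ : Set V)
    (hbrs : IsBasedRootSystem B Δ) (hrank : Δ.ncard = 3)
    (hpsd : ∀ v ∈ Submodule.span ℝ Δ, 0 ≤ B v v)
    (hnpd : ¬ ∀ v ∈ Submodule.span ℝ Δ, v ≠ 0 → 0 < B v v)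
    (d : Set V → Set V) (hd : IsOMRS B Δ d) :
    ∀ X, X ⊆ rootSystem B Δ → d X = cone X ∩ rootSystem B Δ := by
  classical
  obtain ⟨a, b, c, hab, hac, hbc, hΔ⟩ := Set.ncard_eq_three.mp hrank
  have hli := hbrs.indep
  let bs := Module.Basis.span hli
  have ma : a ∈ Δ := by rw [hΔ]; simp
  have mb : b ∈ Δ := by rw [hΔ]; simp
  have mc : c ∈ Δ := by rw [hΔ]; simp
  have dual : ∀ α : Δ, ∃ f : V →ₗ[ℝ] ℝ, ∀ β : Δ, f β = if β = α then 1 else 0 := by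
    intro α
    obtain ⟨f, hf⟩ := LinearMap.exists_extend (bs.coord α)
    refine ⟨f, fun β => ?_⟩
    have h1 : f (bs β) = bs.coord α (bs β) := by rw [← hf]; rfl
    have h2 : ((bs β : Submodule.span ℝ (range ((↑) : Δ → V))) : V) = β :=
      congrArg Subtype.val (Module.Basis.span_apply hli β)
    rw [h2, Module.Basis.coord_apply, Module.Basis.repr_self, Finsupp.single_apply] at h1
    exact h1
  obtain ⟨f0, hf0⟩ := dual ⟨a, ma⟩
  obtain ⟨f1, hf1⟩ := dual ⟨b, mb⟩
  obtain ⟨f2, hf2⟩ := dual ⟨c, mc⟩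
  have C : RootCtx B Δ a b c f0 f1 f2 :=
    { hΔ := hΔ
      f0a := by simpa using hf0 ⟨a, ma⟩
      f0b := by simpa [hab.symm] using hf0 ⟨b, mb⟩
      f0c := by simpa [hac.symm] using hf0 ⟨c, mc⟩
      f1a := by simpa [hab] using hf1 ⟨a, ma⟩
      f1b := by simpa using hf1 ⟨b, mb⟩
      f1c := by simpa [hbc.symm] using hf1 ⟨c, mc⟩
      f2a := by simpa [hac] using hf2 ⟨a, ma⟩
      f2b := by simpa [hbc] using hf2 ⟨b, mb⟩
      f2c := by simpa using hf2 ⟨c, mc⟩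
      symm := hbrs.symm
      diag := hbrs.diag_one }
  have hexp : ∀ x y z : ℝ, B (x • a + y • b + z • c) (x • a + y • b + z • c) =
      x ^ 2 + y ^ 2 + z ^ 2 + 2 * B a b * x * y + 2 * B a c * x * z + 2 * B b c * y * z := by
    intro x y z
    simp only [map_add, map_smul, LinearMap.add_apply, LinearMap.smul_apply, smul_eq_mul,
      hbrs.diag_one a ma, hbrs.diag_one b mb, hbrs.diag_one c mc, hbrs.symm b a, hbrs.symm c a,
      hbrs.symm c b]
    ring
  have hspan : ∀ x y z : ℝ, x • a + y • b + z • c ∈ Submodule.span ℝ Δ := fun x y z =>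
    Submodule.add_mem _ (Submodule.add_mem _ (Submodule.smul_mem _ _ (Submodule.subset_span ma))
      (Submodule.smul_mem _ _ (Submodule.subset_span mb)))
      (Submodule.smul_mem _ _ (Submodule.subset_span mc))
  have hN : Nice (B a b) (B a c) (B b c) := by
    refine nice_of_psd (hbrs.offdiag a ma b mb hab) (hbrs.offdiag a ma c mc hac)
      (hbrs.offdiag b mb c mc hbc) ?_ ?_
    · intro x y z
      rw [← hexp]
      exact hpsd _ (hspan x y z)
    · push Not at hnpd
      obtain ⟨v, hv, hv0, hvB⟩ := hnpd
      have hdec := C.decomp hv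
      refine ⟨f0 v, f1 v, f2 v, ?_, ?_⟩
      · by_contra! h
        rw [h.1, h.2.1, h.2.2] at hdec
        simp at hdec
        exact hv0 hdec
      · rw [← hexp, ← hdec]
        exact le_antisymm hvB (hpsd v hv)
  obtain ⟨m0, m1, m2, K, D, P, N⟩ := hN
  intro X hX
  apply Subset.antisymm
  · intro g hg
    have hgΦ := hd.om.cx_le_ground X hX hg
    refine ⟨?_, hgΦ⟩
    obtain ⟨Y, hYX, hYf, hgY⟩ := hd.om.finitary X hX g hg
    have := d_sub_cone C N hd hgΦ _ hYf.toFinset rfl (by simpa using hYX.trans hX)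
      (by simpa using hgY)
    exact cone_mono hYX (by simpa using this)
  · rintro g ⟨hgc, hgΦ⟩
    obtain ⟨Y, w, hYX, hw, e⟩ := sum_of_cone hgc
    exact hd.om.cx_mono _ _ hYX hX
      (cone_sub_d C N hd hgΦ _ Y w rfl (hYX.trans hX) (fun y _ => hw y) e)
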